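/- arXiv:1010.3654 — 2 statements merged into one kernel-verified Lean document; each statement's English description precedes it below -/
import Mathlib

section
/- Let t ≥ 1, n ≥ 3, and let c ∈ ℝ be such that every eigenvalue of the 3-qubit open-chain moment operator K_t := (1/2)(P^{(12)} + P^{(23)}) is either 1 or at most c. Then every eigenvalue of the n-qubit ring moment operator M_{t,n} := (1/n) ∑_{i∈ℤ/n} ∫_{U(4)} E_i(U)^{⊗t} ⊗ conj(E_i(U))^{⊗t} dμ_H(U) is either 1 or at most 1 − (3 − 4c)/n. (Equivalently, λ₂(M_{t,n}) ≤ 1 − (3 − 4λ₂(M_{t,3}))/n, where λ₂ denotes the largest eigenvalue different from 1.) -/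
open MeasureTheory
open scoped BigOperators Matrix Kronecker

/-- Borel measurable-space structure on unitary groups of complex matrices. -/
noncomputable instance unitaryGroup.measurableSpace (m : Type*) [Fintype m] [DecidableEq m] :
    MeasurableSpace (Matrix.unitaryGroup m ℂ) := borel _

instance unitaryGroup.borelSpace (m : Type*) [Fintype m] [DecidableEq m] :
    BorelSpace (Matrix.unitaryGroup m ℂ) := ⟨rfl⟩

/-- The `t`-fold Kronecker (tensor) power of a matrix, indexed by tuples. -/
def tensorPow {α : Type*} [Fintype α] (t : ℕ) (A : Matrix α α ℂ) :
    Matrix (Fin t → α) (Fin t → α) ℂ :=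
  fun x y => ∏ a : Fin t, A (x a) (y a)

/-- `E_i(U)`: the two-qubit gate `U ∈ U(4)` applied to the neighbouring qubits `i, i+1` of a
ring of `n` qubits, acting as the identity elsewhere. -/
def ringGate (n : ℕ) [NeZero n] (i : ZMod n)
    (U : Matrix (Fin 2 × Fin 2) (Fin 2 × Fin 2) ℂ) :
    Matrix (ZMod n → Fin 2) (ZMod n → Fin 2) ℂ :=
  fun x y => U (x i, x (i + 1)) (y i, y (i + 1)) *
    ∏ k ∈ Finset.univ.filter fun k => k ≠ i ∧ k ≠ i + 1, (if x k = y k then (1 : ℂ) else 0)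

/-- The two-qubit gate `U` applied to qubits `1,2` of an open chain of three qubits. -/
def gate12 (U : Matrix (Fin 2 × Fin 2) (Fin 2 × Fin 2) ℂ) :
    Matrix (Fin 3 → Fin 2) (Fin 3 → Fin 2) ℂ :=
  fun x y => U (x 0, x 1) (y 0, y 1) * (if x 2 = y 2 then (1 : ℂ) else 0)

/-- The two-qubit gate `U` applied to qubits `2,3` of an open chain of three qubits. -/
def gate23 (U : Matrix (Fin 2 × Fin 2) (Fin 2 × Fin 2) ℂ) :
    Matrix (Fin 3 → Fin 2) (Fin 3 → Fin 2) ℂ :=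
  fun x y => U (x 1, x 2) (y 1, y 2) * (if x 0 = y 0 then (1 : ℂ) else 0)

/-- `P^{(12)} = ∫ (U⊗I)^{⊗t} ⊗ conj((U⊗I)^{⊗t}) dμ_H(U)` on three qubits (entrywise). -/
noncomputable def P12 (t : ℕ) (μ : Measure (Matrix.unitaryGroup (Fin 2 × Fin 2) ℂ)) :
    Matrix ((Fin t → Fin 3 → Fin 2) × (Fin t → Fin 3 → Fin 2))
      ((Fin t → Fin 3 → Fin 2) × (Fin t → Fin 3 → Fin 2)) ℂ :=
  fun p q =>
    ∫ U : Matrix.unitaryGroup (Fin 2 × Fin 2) ℂ,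
      ((tensorPow t (gate12 (U : Matrix (Fin 2 × Fin 2) (Fin 2 × Fin 2) ℂ))) ⊗ₖ
        ((tensorPow t (gate12 (U : Matrix (Fin 2 × Fin 2) (Fin 2 × Fin 2) ℂ))).map
          (starRingEnd ℂ))) p q ∂μ

/-- `P^{(23)} = ∫ (I⊗U)^{⊗t} ⊗ conj((I⊗U)^{⊗t}) dμ_H(U)` on three qubits (entrywise). -/
noncomputable def P23 (t : ℕ) (μ : Measure (Matrix.unitaryGroup (Fin 2 × Fin 2) ℂ)) :
    Matrix ((Fin t → Fin 3 → Fin 2) × (Fin t → Fin 3 → Fin 2))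
      ((Fin t → Fin 3 → Fin 2) × (Fin t → Fin 3 → Fin 2)) ℂ :=
  fun p q =>
    ∫ U : Matrix.unitaryGroup (Fin 2 × Fin 2) ℂ,
      ((tensorPow t (gate23 (U : Matrix (Fin 2 × Fin 2) (Fin 2 × Fin 2) ℂ))) ⊗ₖ
        ((tensorPow t (gate23 (U : Matrix (Fin 2 × Fin 2) (Fin 2 × Fin 2) ℂ))).map
          (starRingEnd ℂ))) p q ∂μ

/-- The `n`-qubit ring moment operator
`M_{t,n} = (1/n) ∑_i ∫ E_i(U)^{⊗t} ⊗ conj(E_i(U)^{⊗t}) dμ_H(U)` (entrywise). -/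
noncomputable def ringMoment (n t : ℕ) [NeZero n]
    (μ : Measure (Matrix.unitaryGroup (Fin 2 × Fin 2) ℂ)) :
    Matrix ((Fin t → ZMod n → Fin 2) × (Fin t → ZMod n → Fin 2))
      ((Fin t → ZMod n → Fin 2) × (Fin t → ZMod n → Fin 2)) ℂ :=
  fun p q => (n : ℂ)⁻¹ * ∑ i : ZMod n,
    ∫ U : Matrix.unitaryGroup (Fin 2 × Fin 2) ℂ,
      ((tensorPow t (ringGate n i (U : Matrix (Fin 2 × Fin 2) (Fin 2 × Fin 2) ℂ))) ⊗ₖ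
        ((tensorPow t (ringGate n i (U : Matrix (Fin 2 × Fin 2) (Fin 2 × Fin 2) ℂ))).map
          (starRingEnd ℂ))) p q ∂μ


namespace RingGap

set_option linter.unusedSectionVars false

open Matrix
open scoped ComplexOrder

abbrev U4 := Matrix.unitaryGroup (Fin 2 × Fin 2) ℂ
abbrev M4 := Matrix (Fin 2 × Fin 2) (Fin 2 × Fin 2) ℂ

instance compactU4 : CompactSpace U4 := by
  have h : IsCompact ((Matrix.unitaryGroup (Fin 2 × Fin 2) ℂ : Set M4)) := by
    have hc : IsCompact (Set.pi Set.univ (fun _ : Fin 2 × Fin 2 =>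
        Set.pi Set.univ (fun _ : Fin 2 × Fin 2 => Metric.closedBall (0 : ℂ) 1))) :=
      isCompact_univ_pi fun _ => isCompact_univ_pi fun _ => isCompact_closedBall _ _
    refine IsCompact.of_isClosed_subset hc ?_ ?_
    · exact isClosed_unitary (R := M4)
    · intro U hU i _ j _
      simpa using entry_norm_bound_of_unitary hU i j
  exact isCompact_iff_compactSpace.mp h

/-- `A^{⊗t} ⊗ conj(A)^{⊗t}`. -/
noncomputable def W {X : Type*} [Fintype X] (t : ℕ) (A : Matrix X X ℂ) :
    Matrix ((Fin t → X) × (Fin t → X)) ((Fin t → X) × (Fin t → X)) ℂ :=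
  (tensorPow t A) ⊗ₖ ((tensorPow t A).map (starRingEnd ℂ))

theorem tensorPow_mul {X : Type*} [Fintype X] [DecidableEq X] (t : ℕ) (A B : Matrix X X ℂ) :
    tensorPow t (A * B) = tensorPow t A * tensorPow t B := by
  ext x y
  simp only [tensorPow, Matrix.mul_apply]
  rw [Finset.prod_univ_sum]
  simp [Finset.prod_mul_distrib]

theorem tensorPow_conjTranspose {X : Type*} [Fintype X] (t : ℕ) (A : Matrix X X ℂ) :
    tensorPow t Aᴴ = (tensorPow t A)ᴴ := by
  ext x y
  simp [tensorPow, Matrix.conjTranspose_apply]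

theorem W_mul {X : Type*} [Fintype X] [DecidableEq X] (t : ℕ) (A B : Matrix X X ℂ) :
    W t (A * B) = W t A * W t B := by
  simp only [W]
  rw [tensorPow_mul, ← Matrix.mul_kronecker_mul, Matrix.map_mul]

theorem W_conjTranspose {X : Type*} [Fintype X] (t : ℕ) (A : Matrix X X ℂ) :
    W t Aᴴ = (W t A)ᴴ := by
  simp only [W]
  rw [tensorPow_conjTranspose, Matrix.conjTranspose_kronecker]
  rfl

theorem W_continuous {X : Type*} [Fintype X] (t : ℕ) : Continuous (W (X := X) t) := by
  refine continuous_matrix fun p q => ?_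
  change Continuous fun A : Matrix X X ℂ => (∏ a : Fin t, A (p.1 a) (q.1 a)) *
    (starRingEnd ℂ) (∏ a : Fin t, A (p.2 a) (q.2 a))
  refine Continuous.mul ?_ (Complex.continuous_conj.comp ?_)
  · exact continuous_finsetProd _ fun a _ => continuous_id.matrix_elem _ _
  · exact continuous_finsetProd _ fun a _ => continuous_id.matrix_elem _ _

/-- Entrywise integral. -/
noncomputable def intM {Y : Type*} (μ : Measure U4) (F : U4 → Matrix Y Y ℂ) : Matrix Y Y ℂ :=
  fun p q => ∫ U, F U p q ∂μ

section int
variable {Y : Type*} [Fintype Y] (μ : Measure U4) [IsProbabilityMeasure μ]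

theorem integrable_entry {F : U4 → Matrix Y Y ℂ} (hF : Continuous F) (p q : Y) :
    Integrable (fun U => F U p q) μ := by
  refine Continuous.integrable_of_hasCompactSupport (hF.matrix_elem p q) ?_
  exact HasCompactSupport.of_compactSpace _

theorem mul_intM {F : U4 → Matrix Y Y ℂ} (hF : Continuous F) (A : Matrix Y Y ℂ) :
    A * intM μ F = intM μ (fun U => A * F U) := by
  ext p q
  simp only [intM, Matrix.mul_apply]
  rw [integral_finsetSum _ fun r _ => (integrable_entry μ hF r q).const_mul _]
  simp [integral_const_mul]

theorem intM_mul {F : U4 → Matrix Y Y ℂ} (hF : Continuous F) (A : Matrix Y Y ℂ) :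
    intM μ F * A = intM μ (fun U => F U * A) := by
  ext p q
  simp only [intM, Matrix.mul_apply]
  rw [integral_finsetSum _ fun r _ => (integrable_entry μ hF p r).mul_const _]
  simp [integral_mul_const]

theorem intM_conjTranspose (F : U4 → Matrix Y Y ℂ) :
    (intM μ F)ᴴ = intM μ (fun U => (F U)ᴴ) := by
  ext p q
  simp only [intM, Matrix.conjTranspose_apply]
  exact (integral_conj (f := fun U => F U q p)).symm

theorem intM_const (A : Matrix Y Y ℂ) : intM μ (fun _ => A) = A := by
  ext p q
  simp [intM]

theorem commute_intM {F G : U4 → Matrix Y Y ℂ} (hF : Continuous F) (hG : Continuous G)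
    (h : ∀ U V, F U * G V = G V * F U) : intM μ F * intM μ G = intM μ G * intM μ F := by
  rw [intM_mul μ hF, mul_intM μ hF]
  congr 1
  funext U
  rw [mul_intM μ hG, intM_mul μ hG]
  simp only [h]

/-- Averages of star-representations are Hermitian and idempotent. -/
theorem intM_proj [μ.IsHaarMeasure] {F : U4 → Matrix Y Y ℂ} (hF : Continuous F)
    (hm : ∀ U V, F (U * V) = F U * F V) (hs : ∀ U, F (U⁻¹) = (F U)ᴴ) :
    (intM μ F)ᴴ = intM μ F ∧ intM μ F * intM μ F = intM μ F := by
  have hleft : ∀ g, F g * intM μ F = intM μ F := by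
    intro g
    rw [mul_intM μ hF]
    ext p q
    simp only [intM, ← hm]
    exact integral_mul_left_eq_self (μ := μ) (fun U => F U p q) g
  have h1 : (intM μ F)ᴴ * intM μ F = intM μ F := by
    rw [intM_conjTranspose, intM_mul]
    · simp only [← hs, hleft, intM_const]
    · exact hF.matrix_conjTranspose
  have h2 : (intM μ F)ᴴ = intM μ F := by
    conv_lhs => rw [← h1]
    rw [Matrix.conjTranspose_mul, Matrix.conjTranspose_conjTranspose, h1]
  exact ⟨h2, by rw [h2] at h1; exact h1⟩

end int

section gates
variable {S : Type*} [Fintype S] [DecidableEq S]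

/-- The gate `U` on the ordered pair of sites `i, j`. -/
noncomputable def G (i j : S) (U : M4) : Matrix (S → Fin 2) (S → Fin 2) ℂ :=
  fun x y => U (x i, x j) (y i, y j) *
    if (∀ k, k ≠ i → k ≠ j → x k = y k) then (1 : ℂ) else 0

/-- Splitting the configuration space. -/
def splitG (i j : S) (x : S → Fin 2) :
    (Fin 2 × Fin 2) × ({k : S // k ≠ i ∧ k ≠ j} → Fin 2) :=
  ((x i, x j), fun k => x k)

theorem splitG_bij {i j : S} (hij : i ≠ j) : Function.Bijective (splitG i j) := by
  constructor
  · intro x y h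
    simp only [splitG, Prod.mk.injEq] at h
    obtain ⟨⟨h1, h2⟩, h3⟩ := h
    funext k
    by_cases hi : k = i
    · rw [hi, h1]
    by_cases hj : k = j
    · rw [hj, h2]
    exact congrFun h3 ⟨k, hi, hj⟩
  · rintro ⟨⟨a, b⟩, c⟩
    refine ⟨fun k => if hi : k = i then a else if hj : k = j then b else c ⟨k, hi, hj⟩, ?_⟩
    simp only [splitG, Prod.mk.injEq]
    refine ⟨⟨by simp, by simp [hij.symm]⟩, ?_⟩
    funext k
    simp [k.2.1, k.2.2]

theorem G_eq (i j : S) (U : M4) :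
    G i j U = (U ⊗ₖ (1 : Matrix ({k : S // k ≠ i ∧ k ≠ j} → Fin 2) _ ℂ)).submatrix
      (splitG i j) (splitG i j) := by
  ext x y
  simp only [G, splitG, Matrix.submatrix_apply, Matrix.kroneckerMap_apply, Matrix.one_apply,
    funext_iff, Subtype.forall, and_imp]

theorem G_mul {i j : S} (hij : i ≠ j) (U V : M4) : G i j (U * V) = G i j U * G i j V := by
  rw [G_eq, G_eq, G_eq]
  have := Matrix.submatrix_mul_equiv (U ⊗ₖ (1 : Matrix ({k : S // k ≠ i ∧ k ≠ j} → Fin 2) _ ℂ))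
    (V ⊗ₖ (1 : Matrix ({k : S // k ≠ i ∧ k ≠ j} → Fin 2) _ ℂ)) (splitG i j)
    (Equiv.ofBijective _ (splitG_bij hij)) (splitG i j)
  rw [← Matrix.mul_kronecker_mul, Matrix.one_mul] at this
  exact this.symm

theorem G_conjTranspose (i j : S) (U : M4) : G i j Uᴴ = (G i j U)ᴴ := by
  rw [G_eq, G_eq, Matrix.conjTranspose_submatrix, Matrix.conjTranspose_kronecker,
    Matrix.conjTranspose_one]

theorem G_continuous (i j : S) : Continuous (G i j) := by
  refine continuous_matrix fun x y => ?_
  exact (continuous_id.matrix_elem _ _).mul continuous_const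

theorem G_mul_disjoint {i j k l : S} (hik : i ≠ k) (hil : i ≠ l) (hjk : j ≠ k) (hjl : j ≠ l)
    (U V : M4) (x y : S → Fin 2) :
    (G i j U * G k l V) x y = (U (x i, x j) (y i, y j) * V (x k, x l) (y k, y l)) *
      if (∀ m, m ≠ i → m ≠ j → m ≠ k → m ≠ l → x m = y m) then (1 : ℂ) else 0 := by
  rw [Matrix.mul_apply, Finset.sum_eq_single (fun m => if m = i ∨ m = j then y m else x m)]
  · simp only [G]
    have h1 : ∀ m, m ≠ i → m ≠ j → x m = if m = i ∨ m = j then y m else x m := by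
      intro m h h'; simp [h, h']
    have h2 : (∀ m, m ≠ k → m ≠ l → (if m = i ∨ m = j then y m else x m) = y m) ↔
        (∀ m, m ≠ i → m ≠ j → m ≠ k → m ≠ l → x m = y m) := by
      constructor
      · intro h m a b c d
        simpa [a, b] using h m c d
      · intro h m c d
        by_cases hm : m = i ∨ m = j
        · simp [hm]
        · simp only [hm, if_false]
          push Not at hm
          exact h m hm.1 hm.2 c d
    rw [if_pos h1]
    simp only [h2]
    simp [hik.symm, hil.symm, hjk.symm, hjl.symm]
  · intro z _ hz
    simp only [G]
    by_cases h1 : ∀ m, m ≠ i → m ≠ j → x m = z m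
    · by_cases h2 : ∀ m, m ≠ k → m ≠ l → z m = y m
      · exfalso
        apply hz
        funext m
        by_cases hm : m = i ∨ m = j
        · simp only [hm, if_true]
          rcases hm with rfl | rfl
          · exact h2 _ hik hil
          · exact h2 _ hjk hjl
        · simp only [hm, if_false]
          push Not at hm
          exact (h1 m hm.1 hm.2).symm
      · rw [if_neg h2]; simp
    · rw [if_neg h1]; simp
  · simp

theorem G_comm {i j k l : S} (hik : i ≠ k) (hil : i ≠ l) (hjk : j ≠ k) (hjl : j ≠ l)
    (U V : M4) : G i j U * G k l V = G k l V * G i j U := by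
  ext x y
  rw [G_mul_disjoint hik hil hjk hjl, G_mul_disjoint hik.symm hjk.symm hil.symm hjl.symm]
  have : (∀ m, m ≠ i → m ≠ j → m ≠ k → m ≠ l → x m = y m) ↔
      (∀ m, m ≠ k → m ≠ l → m ≠ i → m ≠ j → x m = y m) :=
    ⟨fun h m a b c d => h m c d a b, fun h m a b c d => h m c d a b⟩
  simp only [this]
  ring

/-- The averaged gate on sites `i,j`. -/
noncomputable def Q (t : ℕ) (μ : Measure U4) (i j : S) :
    Matrix ((Fin t → S → Fin 2) × (Fin t → S → Fin 2))
      ((Fin t → S → Fin 2) × (Fin t → S → Fin 2)) ℂ :=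
  intM μ (fun U => W t (G i j (U : M4)))

theorem WG_continuous (t : ℕ) (i j : S) : Continuous (fun U : U4 => W t (G i j (U : M4))) :=
  (W_continuous t).comp ((G_continuous i j).comp continuous_subtype_val)

theorem Q_proj (t : ℕ) (μ : Measure U4) [μ.IsHaarMeasure] [IsProbabilityMeasure μ]
    {i j : S} (hij : i ≠ j) : (Q t μ i j)ᴴ = Q t μ i j ∧ Q t μ i j * Q t μ i j = Q t μ i j := by
  refine intM_proj μ (WG_continuous t i j) ?_ ?_
  · intro U V
    rw [← W_mul, ← G_mul hij]
    rfl
  · intro U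
    rw [← W_conjTranspose, ← G_conjTranspose]
    rfl

theorem Q_comm (t : ℕ) (μ : Measure U4) [IsProbabilityMeasure μ]
    {i j k l : S} (hik : i ≠ k) (hil : i ≠ l) (hjk : j ≠ k) (hjl : j ≠ l) :
    Q t μ i j * Q t μ k l = Q t μ k l * Q t μ i j := by
  refine commute_intM μ (WG_continuous t i j) (WG_continuous t k l) ?_
  intro U V
  rw [← W_mul, ← W_mul, G_comm hik hil hjk hjl]

variable {T : Type*} [Fintype T] [DecidableEq T]

abbrev Cf (t : ℕ) (S : Type*) := (Fin t → S → Fin 2) × (Fin t → S → Fin 2)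

/-- Splitting along an embedding of sites. -/
def splitE (t : ℕ) (f : S → T) (p : Cf t T) : Cf t S × Cf t {k : T // k ∉ Set.range f} :=
  ((fun a k => p.1 a (f k), fun a k => p.2 a (f k)), (fun a k => p.1 a k, fun a k => p.2 a k))

theorem splitE_bij (t : ℕ) {f : S → T} (hf : Function.Injective f) :
    Function.Bijective (splitE t f) := by
  have inj : ∀ x y : Fin t → T → Fin 2, (fun a k => x a (f k)) = (fun a k => y a (f k)) →
      (fun a (k : {k : T // k ∉ Set.range f}) => x a k) =
        (fun a (k : {k : T // k ∉ Set.range f}) => y a k) → x = y := by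
    intro x y h1 h2
    funext a k
    by_cases hk : k ∈ Set.range f
    · obtain ⟨m, rfl⟩ := hk
      exact congrFun (congrFun h1 a) m
    · exact congrFun (congrFun h2 a) ⟨k, hk⟩
  have sur : ∀ (u : Fin t → S → Fin 2) (v : Fin t → {k : T // k ∉ Set.range f} → Fin 2),
      ∃ x : Fin t → T → Fin 2, (fun a k => x a (f k)) = u ∧
        (fun a (k : {k : T // k ∉ Set.range f}) => x a k) = v := by
    classical
    intro u v
    refine ⟨fun a k => if hk : k ∈ Set.range f then u a hk.choose else v a ⟨k, hk⟩, ?_, ?_⟩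
    · funext a k
      have hk : f k ∈ Set.range f := ⟨k, rfl⟩
      simp only [hk, dif_pos]
      rw [hf hk.choose_spec]
    · funext a k
      simp only [k.2, dif_neg, not_false_eq_true]
  constructor
  · intro p q h
    simp only [splitE, Prod.mk.injEq] at h
    exact Prod.ext (inj _ _ h.1.1 h.2.1) (inj _ _ h.1.2 h.2.2)
  · rintro ⟨⟨u1, u2⟩, ⟨v1, v2⟩⟩
    obtain ⟨x1, h1, h1'⟩ := sur u1 v1
    obtain ⟨x2, h2, h2'⟩ := sur u2 v2
    refine ⟨(x1, x2), ?_⟩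
    simp only [splitE, h1, h2, h1', h2']

theorem G_embed {f : S → T} (hf : Function.Injective f) (i j : S) (U : M4) (x y : T → Fin 2) :
    G (f i) (f j) U x y = G i j U (fun k => x (f k)) (fun k => y (f k)) *
      (if (∀ k : {k : T // k ∉ Set.range f}, x k = y k) then (1 : ℂ) else 0) := by
  simp only [G]
  rw [mul_assoc, ite_zero_mul_ite_zero, one_mul]
  congr 1
  refine if_congr ?_ rfl rfl
  constructor
  · intro h
    refine ⟨fun k hi hj => h _ (hf.ne hi) (hf.ne hj), ?_⟩
    rintro ⟨k, hk⟩
    exact h k (fun e => hk ⟨i, e.symm⟩) (fun e => hk ⟨j, e.symm⟩)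
  · rintro ⟨h1, h2⟩ k hi hj
    by_cases hk : k ∈ Set.range f
    · obtain ⟨m, rfl⟩ := hk
      exact h1 m (fun e => hi (by rw [e])) (fun e => hj (by rw [e]))
    · exact h2 ⟨k, hk⟩

theorem WG_embed (t : ℕ) {f : S → T} (hf : Function.Injective f) (i j : S) (U : M4)
    (p q : Cf t T) :
    W t (G (f i) (f j) U) p q = W t (G i j U) (splitE t f p).1 (splitE t f q).1 *
      (1 : Matrix (Cf t {k : T // k ∉ Set.range f}) (Cf t {k : T // k ∉ Set.range f}) ℂ)
        (splitE t f p).2 (splitE t f q).2 := by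
  simp only [W, Matrix.kroneckerMap_apply, Matrix.map_apply, tensorPow, G_embed hf,
    Finset.prod_mul_distrib, map_mul, Finset.prod_ite_zero, Finset.prod_const_one, map_prod,
    splitE, Matrix.one_apply, Prod.mk.injEq, funext_iff, Finset.mem_univ, true_implies,
    apply_ite (starRingEnd ℂ), map_one, map_zero]
  rw [mul_mul_mul_comm, ite_zero_mul_ite_zero, one_mul]

/-- The lift of an operator along an embedding of sites. -/
noncomputable def lift (t : ℕ) (f : S → T) (A : Matrix (Cf t S) (Cf t S) ℂ) :
    Matrix (Cf t T) (Cf t T) ℂ :=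
  (A ⊗ₖ (1 : Matrix (Cf t {k : T // k ∉ Set.range f}) _ ℂ)).submatrix (splitE t f) (splitE t f)

theorem Q_embed (t : ℕ) (μ : Measure U4) {f : S → T} (hf : Function.Injective f) (i j : S) :
    Q t μ (f i) (f j) = lift t f (Q t μ i j) := by
  ext p q
  simp only [Q, intM, lift, Matrix.submatrix_apply, Matrix.kroneckerMap_apply, WG_embed t hf]
  rw [integral_mul_const]

theorem lift_mul (t : ℕ) {f : S → T} (hf : Function.Injective f)
    (A B : Matrix (Cf t S) (Cf t S) ℂ) : lift t f (A * B) = lift t f A * lift t f B := by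
  have := Matrix.submatrix_mul_equiv
    (A ⊗ₖ (1 : Matrix (Cf t {k : T // k ∉ Set.range f}) _ ℂ))
    (B ⊗ₖ (1 : Matrix (Cf t {k : T // k ∉ Set.range f}) _ ℂ)) (splitE t f)
    (Equiv.ofBijective _ (splitE_bij t hf)) (splitE t f)
  rw [← Matrix.mul_kronecker_mul, Matrix.one_mul] at this
  exact this.symm

theorem lift_one (t : ℕ) {f : S → T} (hf : Function.Injective f) :
    lift t f (1 : Matrix (Cf t S) (Cf t S) ℂ) = 1 := by
  ext p q
  simp only [lift, Matrix.submatrix_apply, Matrix.kroneckerMap_apply, Matrix.one_apply]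
  by_cases h : p = q
  · simp [h]
  · rw [if_neg h, ite_zero_mul_ite_zero, if_neg]
    rintro ⟨h1, h2⟩
    exact h ((splitE_bij t hf).1 (Prod.ext h1 h2))

theorem lift_sub (t : ℕ) (f : S → T) (A B : Matrix (Cf t S) (Cf t S) ℂ) :
    lift t f (A - B) = lift t f A - lift t f B := by
  ext p q
  simp [lift, sub_mul]

theorem lift_add (t : ℕ) (f : S → T) (A B : Matrix (Cf t S) (Cf t S) ℂ) :
    lift t f (A + B) = lift t f A + lift t f B := by
  ext p q
  simp [lift, add_mul]

theorem lift_smul (t : ℕ) (f : S → T) (a : ℂ) (A : Matrix (Cf t S) (Cf t S) ℂ) :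
    lift t f (a • A) = a • lift t f A := by
  ext p q
  simp [lift, mul_assoc]

theorem lift_psd (t : ℕ) (f : S → T) {A : Matrix (Cf t S) (Cf t S) ℂ} (hA : A.PosSemidef) :
    (lift t f A).PosSemidef :=
  (hA.kronecker Matrix.PosSemidef.one).submatrix _

end gates

section spectral
variable {Y : Type*} [Fintype Y] [DecidableEq Y]

theorem psd_of_proj {h : Matrix Y Y ℂ} (h1 : hᴴ = h) (h2 : h * h = h) : h.PosSemidef := by
  have := Matrix.posSemidef_conjTranspose_mul_self h
  rwa [h1, h2] at this

theorem one_sub_proj {h : Matrix Y Y ℂ} (h1 : hᴴ = h) (h2 : h * h = h) :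
    (1 - h)ᴴ = 1 - h ∧ (1 - h) * (1 - h) = 1 - h := by
  refine ⟨by rw [Matrix.conjTranspose_sub, Matrix.conjTranspose_one, h1], ?_⟩
  rw [sub_mul, mul_sub, mul_sub, h2]
  simp

theorem psd_mul_of_comm {h k : Matrix Y Y ℂ} (h1 : hᴴ = h) (h2 : h * h = h)
    (k1 : kᴴ = k) (k2 : k * k = k) (hk : h * k = k * h) : (h * k).PosSemidef := by
  apply psd_of_proj
  · rw [Matrix.conjTranspose_mul, h1, k1, hk]
  · calc h * k * (h * k) = h * (k * h) * k := by simp only [mul_assoc]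
      _ = (h * h) * (k * k) := by rw [← hk]; simp only [mul_assoc]
      _ = h * k := by rw [h2, k2]

/-- Quadratic form of a real multiple. -/
theorem psd_eig_nonneg {A : Matrix Y Y ℂ} (hA : A.PosSemidef) {v : Y → ℂ} (hv : v ≠ 0) {a : ℝ}
    (h : A *ᵥ v = (a : ℂ) • v) : 0 ≤ a := by
  have h0 := hA.dotProduct_mulVec_nonneg v
  rw [h, dotProduct_smul, smul_eq_mul] at h0
  have hp : 0 < star v ⬝ᵥ v := dotProduct_star_self_pos_iff.mpr hv
  by_contra hneg
  push Not at hneg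
  have : (a : ℂ) * (star v ⬝ᵥ v) < 0 :=
    mul_neg_of_neg_of_pos (by exact_mod_cast hneg) hp
  exact absurd h0 (not_le_of_gt this)

theorem psd_poly {K : Matrix Y Y ℂ} (hK : K.IsHermitian) (c : ℝ)
    (h : ∀ x : ℝ, (∃ v, v ≠ 0 ∧ K *ᵥ v = (x : ℂ) • v) → 0 ≤ (1 - x) * (c - x)) :
    ((1 - K) * ((c : ℂ) • (1 : Matrix Y Y ℂ) - K)).PosSemidef := by
  set V : Matrix Y Y ℂ := (hK.eigenvectorUnitary : Matrix Y Y ℂ) with hV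
  have hVV : V * Vᴴ = 1 := (Matrix.mem_unitaryGroup_iff).1 hK.eigenvectorUnitary.2
  have hVV' : Vᴴ * V = 1 := (Matrix.mem_unitaryGroup_iff').1 hK.eigenvectorUnitary.2
  set D : Matrix Y Y ℂ := Matrix.diagonal (fun i => (hK.eigenvalues i : ℂ)) with hD
  have hKD : K = V * D * Vᴴ := by
    have := hK.spectral_theorem
    rw [Unitary.conjStarAlgAut_apply] at this
    exact this
  have e1 : 1 - K = V * (1 - D) * Vᴴ := by
    rw [mul_sub, sub_mul, ← hKD, mul_one, hVV]
  have e2 : (c : ℂ) • (1 : Matrix Y Y ℂ) - K = V * ((c : ℂ) • (1 : Matrix Y Y ℂ) - D) * Vᴴ := by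
    rw [mul_sub, sub_mul, ← hKD, mul_smul_comm, smul_mul_assoc, mul_one, hVV]
  have e3 : (1 - K) * ((c : ℂ) • (1 : Matrix Y Y ℂ) - K) =
      V * ((1 - D) * ((c : ℂ) • (1 : Matrix Y Y ℂ) - D)) * Vᴴ := by
    rw [e2, e1]
    calc V * (1 - D) * Vᴴ * (V * ((c : ℂ) • (1 : Matrix Y Y ℂ) - D) * Vᴴ)
        = V * (1 - D) * (Vᴴ * V) * ((c : ℂ) • (1 : Matrix Y Y ℂ) - D) * Vᴴ := by
          simp only [mul_assoc]
      _ = _ := by rw [hVV']; simp only [mul_assoc, one_mul]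
  rw [e3]
  apply Matrix.PosSemidef.mul_mul_conjTranspose_same
  have e4 : (1 - D) * ((c : ℂ) • (1 : Matrix Y Y ℂ) - D) = Matrix.diagonal
      (fun i => (((1 - hK.eigenvalues i) * (c - hK.eigenvalues i) : ℝ) : ℂ)) := by
    rw [hD, Matrix.smul_one_eq_diagonal, ← Matrix.diagonal_one, Matrix.diagonal_sub,
      Matrix.diagonal_sub, Matrix.diagonal_mul_diagonal]
    simp
  rw [e4]
  apply Matrix.PosSemidef.diagonal
  intro i
  have := h (hK.eigenvalues i) ⟨WithLp.ofLp (hK.eigenvectorBasis i), ?_, ?_⟩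
  · simpa only [Pi.zero_apply] using (Complex.zero_le_real.mpr this)
  · intro h0
    have h1 := hK.eigenvectorBasis.orthonormal.ne_zero i
    exact h1 ((WithLp.ofLp_eq_zero 2).1 h0)
  · rw [hK.mulVec_eigenvectorBasis]
    ext; simp

/-- The Knabe-type estimate for two projections: `A = (1-P)+(1-R)`. -/
theorem pair_psd {P R : Matrix Y Y ℂ} (hP : Pᴴ = P ∧ P * P = P) (hR : Rᴴ = R ∧ R * R = R) (c : ℝ)
    (hK : ∀ x : ℝ, (∃ v, v ≠ 0 ∧ ((1 / 2 : ℂ) • (P + R)) *ᵥ v = (x : ℂ) • v) → x = 1 ∨ x ≤ c) :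
    (((1 - P) + (1 - R)) * ((1 - P) + (1 - R))
      - ((2 - 2 * c : ℝ) : ℂ) • ((1 - P) + (1 - R))).PosSemidef := by
  set K := (1 / 2 : ℂ) • (P + R) with hKdef
  have hH : K.IsHermitian := by
    rw [Matrix.IsHermitian, hKdef, Matrix.conjTranspose_smul, Matrix.conjTranspose_add, hP.1, hR.1]
    simp
  have h2 : (1 - P) + (1 - R) = (2 : ℂ) • (1 - K) := by
    rw [hKdef, smul_sub, smul_smul]
    norm_num
    rw [two_smul]
    abel
  have hA : ((1 - P) + (1 - R)).PosSemidef :=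
    (psd_of_proj (one_sub_proj hP.1 hP.2).1 (one_sub_proj hP.1 hP.2).2).add
      (psd_of_proj (one_sub_proj hR.1 hR.2).1 (one_sub_proj hR.1 hR.2).2)
  have hpoly := psd_poly hH c (by
    rintro x ⟨v, hv, hx⟩
    have hle : 0 ≤ 2 * (1 - x) := by
      refine psd_eig_nonneg hA hv ?_
      rw [h2, Matrix.smul_mulVec, Matrix.sub_mulVec, hx, Matrix.one_mulVec]
      ext
      simp
      ring
    rcases hK x ⟨v, hv, hx⟩ with h | h
    · simp [h]
    · exact mul_nonneg (by linarith) (by linarith))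
  have e : ((1 - P) + (1 - R)) * ((1 - P) + (1 - R))
      - ((2 - 2 * c : ℝ) : ℂ) • ((1 - P) + (1 - R)) =
      (4 : ℂ) • ((1 - K) * ((c : ℂ) • (1 : Matrix Y Y ℂ) - K)) := by
    rw [h2]
    have : (c : ℂ) • (1 : Matrix Y Y ℂ) - K = (1 - K) - ((1 - c : ℝ) : ℂ) • 1 := by
      push_cast
      rw [sub_smul, one_smul]
      abel
    rw [this, mul_sub, mul_smul_comm, smul_mul_assoc, mul_smul_comm, mul_one, smul_smul, smul_smul,
      smul_sub (4 : ℂ), smul_smul (4 : ℂ)]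
    push_cast
    congr 1
    · norm_num
    · congr 1; ring
  rw [e]
  exact hpoly.smul (by norm_num)

end spectral

section knabe
variable {Y : Type*} [Fintype Y] [DecidableEq Y]

theorem knabe (n : ℕ) [NeZero n] (hn : 3 ≤ n) (h : ZMod n → Matrix Y Y ℂ) (c : ℝ)
    (hp : ∀ i, (h i)ᴴ = h i ∧ h i * h i = h i)
    (hc : ∀ i j, j ≠ i → j ≠ i + 1 → j ≠ i - 1 → h i * h j = h j * h i)
    (hA : ∀ i, ((h i + h (i + 1)) * (h i + h (i + 1))
      - ((2 - 2 * c : ℝ) : ℂ) • (h i + h (i + 1))).PosSemidef) :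
    ((∑ i, h i) * (∑ i, h i) - ((3 - 4 * c : ℝ) : ℂ) • ∑ i, h i).PosSemidef := by
  have hone : (1 : ZMod n) ≠ 0 := by
    have : Fact (1 < n) := ⟨by omega⟩
    exact one_ne_zero
  have htwo : (1 : ZMod n) + 1 ≠ 0 := by
    intro h2
    have h3 : ((2 : ℕ) : ZMod n) = 0 := by
      push_cast; rw [← h2]; norm_num
    rw [ZMod.natCast_eq_zero_iff] at h3
    have := Nat.le_of_dvd (by norm_num) h3
    omega
  set H := ∑ i, h i with hH
  have hshift : ∑ i, h (i + 1) = H := Equiv.sum_comp (Equiv.addRight (1 : ZMod n)) h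
  set R : Matrix Y Y ℂ := ∑ i, ∑ j ∈ Finset.univ.filter
    (fun j => j ≠ i ∧ j ≠ i + 1 ∧ j ≠ i - 1), h i * h j with hR
  have hsq : H * H = H + ∑ i, h i * h (i + 1) + ∑ i, h (i + 1) * h i + R := by
    have hs2 : ∑ i, h (i + 1) * h i = ∑ i, h i * h (i - 1) := by
      rw [← Equiv.sum_comp (Equiv.addRight (1 : ZMod n)) (fun i => h i * h (i - 1))]
      simp
    have hs1 : H = ∑ i, h i * h i := by
      rw [hH]; exact Finset.sum_congr rfl fun i _ => (hp i).2.symm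
    rw [hs2]
    conv_rhs => rw [hs1]
    rw [hR, hH, Finset.sum_mul_sum, ← Finset.sum_add_distrib, ← Finset.sum_add_distrib,
      ← Finset.sum_add_distrib]
    refine Finset.sum_congr rfl fun i _ => ?_
    rw [← Finset.sum_filter_add_sum_filter_not Finset.univ
      (fun j => j ≠ i ∧ j ≠ i + 1 ∧ j ≠ i - 1), add_comm]
    congr 1
    have hf : (Finset.univ.filter fun j => ¬ (j ≠ i ∧ j ≠ i + 1 ∧ j ≠ i - 1)) =
        {i, i + 1, i - 1} := by
      ext j
      simp only [Finset.mem_filter, Finset.mem_univ, true_and, Finset.mem_insert,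
        Finset.mem_singleton]
      tauto
    have n1 : i ≠ i + 1 := by
      intro e; exact hone (by simpa using e.symm)
    have n2 : i ≠ i - 1 := by
      intro e; exact hone (by simpa using e.symm)
    have n3 : i + 1 ≠ i - 1 := by
      intro e
      apply htwo
      have : i + 1 + 1 = i := by rw [e]; ring
      rw [add_assoc] at this
      simpa using this
    rw [hf, Finset.sum_insert (by simp [n1, n2]), Finset.sum_insert (by simp [n3]),
      Finset.sum_singleton, add_assoc]
  have hRpsd : R.PosSemidef := by
    refine Matrix.posSemidef_sum _ fun i _ => Matrix.posSemidef_sum _ fun j hj => ?_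
    simp only [Finset.mem_filter, Finset.mem_univ, true_and] at hj
    exact psd_mul_of_comm (hp i).1 (hp i).2 (hp j).1 (hp j).2 (hc i j hj.1 hj.2.1 hj.2.2)
  have hS : (∑ i, ((h i + h (i + 1)) * (h i + h (i + 1))
      - ((2 - 2 * c : ℝ) : ℂ) • (h i + h (i + 1)))).PosSemidef :=
    Matrix.posSemidef_sum _ fun i _ => hA i
  have hSe : ∑ i, ((h i + h (i + 1)) * (h i + h (i + 1))
      - ((2 - 2 * c : ℝ) : ℂ) • (h i + h (i + 1))) =
      H + H + ∑ i, h i * h (i + 1) + ∑ i, h (i + 1) * h i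
        - ((2 - 2 * c : ℝ) : ℂ) • (H + H) := by
    rw [Finset.sum_sub_distrib, ← Finset.smul_sum, Finset.sum_add_distrib, hshift]
    congr 1
    have : ∀ i, (h i + h (i + 1)) * (h i + h (i + 1)) =
        h i + h (i + 1) + h i * h (i + 1) + h (i + 1) * h i := by
      intro i
      rw [add_mul, mul_add, mul_add, (hp i).2, (hp (i + 1)).2]
      abel
    simp only [this, Finset.sum_add_distrib, hshift]
    rfl
  have key : H * H - ((3 - 4 * c : ℝ) : ℂ) • H = (∑ i, ((h i + h (i + 1)) * (h i + h (i + 1))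
      - ((2 - 2 * c : ℝ) : ℂ) • (h i + h (i + 1)))) + R := by
    rw [hSe, hsq]
    push_cast
    module
  rw [key]
  exact hS.add hRpsd

end knabe

theorem ringGate_eq (n : ℕ) [NeZero n] (i : ZMod n) (U : M4) : ringGate n i U = G i (i + 1) U := by
  ext x y
  simp only [ringGate, G, Finset.prod_ite_zero, Finset.prod_const_one, Finset.mem_filter,
    Finset.mem_univ, true_and, and_imp]

theorem gate12_eq (U : M4) : gate12 U = G (0 : Fin 3) 1 U := by
  ext x y
  simp [gate12, G, Fin.forall_fin_succ]

theorem gate23_eq (U : M4) : gate23 U = G (1 : Fin 3) 2 U := by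
  ext x y
  simp [gate23, G, Fin.forall_fin_succ]

theorem P12_eq (t : ℕ) (μ : Measure U4) : P12 t μ = Q t μ (0 : Fin 3) 1 := by
  ext p q
  simp only [P12, Q, intM, W, gate12_eq]

theorem P23_eq (t : ℕ) (μ : Measure U4) : P23 t μ = Q t μ (1 : Fin 3) 2 := by
  ext p q
  simp only [P23, Q, intM, W, gate23_eq]

theorem ringMoment_eq (n t : ℕ) [NeZero n] (μ : Measure U4) :
    ringMoment n t μ = (n : ℂ)⁻¹ • ∑ i : ZMod n, Q t μ i (i + 1) := by
  ext p q
  simp only [ringMoment, Q, intM, W, ringGate_eq, Matrix.smul_apply, Matrix.sum_apply, smul_eq_mul]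

/-- Three consecutive sites. -/
def site (n : ℕ) (i : ZMod n) (k : Fin 3) : ZMod n := i + ((k : ℕ) : ZMod n)

theorem site_inj (n : ℕ) (hn : 3 ≤ n) (i : ZMod n) : Function.Injective (site n i) := by
  intro a b hab
  have h := add_left_cancel hab
  rw [ZMod.natCast_eq_natCast_iff'] at h
  rw [Nat.mod_eq_of_lt (by omega), Nat.mod_eq_of_lt (by omega)] at h
  exact Fin.ext h

theorem main (t n : ℕ) [NeZero n] (hn : 3 ≤ n) (c : ℝ)
    (μ : Measure U4) [μ.IsHaarMeasure] [IsProbabilityMeasure μ]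
    (hK : ∀ x : ℝ, (∃ v, v ≠ 0 ∧
          ((1 / 2 : ℂ) • (P12 t μ + P23 t μ)).mulVec v = (x : ℂ) • v) → x = 1 ∨ x ≤ c)
    (x : ℝ) (v : Cf t (ZMod n) → ℂ) (hv : v ≠ 0)
    (hx : (ringMoment n t μ).mulVec v = (x : ℂ) • v) :
    x = 1 ∨ x ≤ 1 - (3 - 4 * c) / n := by
  have hone : (1 : ZMod n) ≠ 0 := by
    have : Fact (1 < n) := ⟨by omega⟩
    exact one_ne_zero
  have hii : ∀ i : ZMod n, i ≠ i + 1 := by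
    intro i e; exact hone (by simpa using e.symm)
  have hn0 : (0 : ℝ) < n := by exact_mod_cast (by omega : 0 < n)
  have h3 := pair_psd (Q_proj t μ (by decide : (0 : Fin 3) ≠ 1))
    (Q_proj t μ (by decide : (1 : Fin 3) ≠ 2)) c (by rw [← P12_eq, ← P23_eq]; exact hK)
  let h : ZMod n → Matrix (Cf t (ZMod n)) (Cf t (ZMod n)) ℂ := fun i => 1 - Q t μ i (i + 1)
  have hp : ∀ i, (h i)ᴴ = h i ∧ h i * h i = h i := fun i =>
    one_sub_proj (Q_proj t μ (hii i)).1 (Q_proj t μ (hii i)).2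
  have hkn := knabe n hn h c hp
    (by
      intro i j h1 h2 h3
      have hq := Q_comm t μ (i := i) (j := i + 1) (k := j) (l := j + 1) h1.symm
        (by intro e; exact h3 (by rw [e]; ring)) h2.symm
        (by intro e; exact h1 (add_right_cancel e).symm)
      simp only [h]
      rw [sub_mul, mul_sub, mul_sub, sub_mul, mul_sub, mul_sub, hq]
      simp only [one_mul, mul_one]
      abel)
    (by
      intro i
      have hl := lift_psd t (site n i) h3
      have hf := site_inj n hn i
      rw [lift_sub, lift_smul, lift_mul t hf, lift_add, lift_sub, lift_sub, lift_one t hf,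
        ← Q_embed t μ hf, ← Q_embed t μ hf] at hl
      have s0 : site n i 0 = i := by simp [site]
      have s1 : site n i 1 = i + 1 := by simp [site]
      have s2 : site n i 2 = i + 1 + 1 := by
        simp only [site, Fin.val_two]
        push_cast
        ring
      rw [s0, s1, s2] at hl
      exact hl)
  have hHv : (∑ i, h i) *ᵥ v = ((n * (1 - x) : ℝ) : ℂ) • v := by
    have e : ∑ i, h i = (n : ℂ) • (1 - ringMoment n t μ) := by
      rw [ringMoment_eq, smul_sub, smul_smul, mul_inv_cancel₀ (by exact_mod_cast hn0.ne'), one_smul]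
      simp only [h, Finset.sum_sub_distrib]
      congr 1
      simp [ZMod.card, Nat.cast_smul_eq_nsmul]
    rw [e, Matrix.smul_mulVec, Matrix.sub_mulVec, hx, Matrix.one_mulVec]
    push_cast
    module
  have hE0 : 0 ≤ n * (1 - x) := by
    refine psd_eig_nonneg (Matrix.posSemidef_sum _ fun i _ => psd_of_proj (hp i).1 (hp i).2) hv hHv
  have hE1 : 0 ≤ (n * (1 - x)) * (n * (1 - x)) - (3 - 4 * c) * (n * (1 - x)) := by
    refine psd_eig_nonneg hkn hv ?_
    rw [Matrix.sub_mulVec, Matrix.smul_mulVec, ← Matrix.mulVec_mulVec, hHv, Matrix.mulVec_smul, hHv]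
    push_cast
    module
  by_cases h1 : x = 1
  · exact Or.inl h1
  right
  have hpos : 0 < n * (1 - x) := lt_of_le_of_ne hE0 (by
    intro e
    rcases mul_eq_zero.mp e.symm with e | e
    · exact hn0.ne' e
    · exact h1 (by linarith))
  have h5 : 0 ≤ n * (1 - x) - (3 - 4 * c) := by
    by_contra hh
    push Not at hh
    nlinarith
  have h6 : (3 - 4 * c) / n ≤ 1 - x := by
    rw [div_le_iff₀ hn0]; linarith
  linarith

end RingGap

/-- If every eigenvalue of the 3-qubit open-chain moment operator
`K_t = (1/2)(P^{(12)} + P^{(23)})` is `1` or at most `c`, then every eigenvalue of the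
`n`-qubit ring moment operator `M_{t,n}` is `1` or at most `1 - (3 - 4c)/n`. -/
theorem ring_moment_gap_from_three_qubits
    (t n : ℕ) [NeZero n] (ht : 1 ≤ t) (hn : 3 ≤ n) (c : ℝ)
    (μ : Measure (Matrix.unitaryGroup (Fin 2 × Fin 2) ℂ))
    [μ.IsHaarMeasure] [IsProbabilityMeasure μ]
    (hK : ∀ x : ℝ,
      (∃ v, v ≠ 0 ∧
          ((1 / 2 : ℂ) • (P12 t μ + P23 t μ)).mulVec v = (x : ℂ) • v) →
        x = 1 ∨ x ≤ c) :
    ∀ x : ℝ,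
      (∃ v, v ≠ 0 ∧ (ringMoment n t μ).mulVec v = (x : ℂ) • v) →
        x = 1 ∨ x ≤ 1 - (3 - 4 * c) / n := by
  rintro x ⟨v, hv, hx⟩
  exact RingGap.main t n hn c μ hK x v hv hx
end

section
/- For t ∈ {2, 3}, the 3-qubit open-chain moment operator K_t := (1/2)(P^{(12)} + P^{(23)}) satisfies: every eigenvalue of K_t is either equal to 1 or at most 7/10, and 7/10 is an eigenvalue of K_t. That is, the second largest (distinct) eigenvalue of K_t equals 7/10. -/
open MeasureTheory
open scoped BigOperators Matrix Kronecker

namespace TQM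

abbrev D := Fin 2 × Fin 2
abbrev UG := Matrix.unitaryGroup D ℂ

section TensorPow
variable {α : Type*} [Fintype α] [DecidableEq α]

lemma tensorPow_mul (t : ℕ) (A B : Matrix α α ℂ) :
    tensorPow t (A * B) = tensorPow t A * tensorPow t B := by
  ext x y
  simp only [tensorPow, Matrix.mul_apply]
  rw [Finset.prod_univ_sum]
  simp [Finset.prod_mul_distrib]

lemma tensorPow_one (t : ℕ) : tensorPow t (1 : Matrix α α ℂ) = 1 := by
  ext x y
  simp only [tensorPow, Matrix.one_apply]
  rw [Finset.prod_ite_zero]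
  simp [funext_iff]

lemma tensorPow_conjTranspose (t : ℕ) (A : Matrix α α ℂ) :
    tensorPow t Aᴴ = (tensorPow t A)ᴴ := by
  ext x y
  simp [tensorPow, Matrix.conjTranspose_apply]

/-- permutation operator -/
def RR {t : ℕ} (σ : Equiv.Perm (Fin t)) : Matrix (Fin t → α) (Fin t → α) ℂ :=
  fun i j => if i = j ∘ σ then 1 else 0

lemma RR_comm {t : ℕ} (σ : Equiv.Perm (Fin t)) (V : Matrix α α ℂ) :
    RR σ * tensorPow t V = tensorPow t V * RR σ := by
  ext i k
  simp only [RR, Matrix.mul_apply, tensorPow]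
  have h1 : ∀ j : Fin t → α, (i = j ∘ σ) ↔ (j = i ∘ σ.symm) := by
    intro j
    constructor
    · rintro rfl; ext a; simp
    · rintro rfl; ext a; simp
  simp only [h1, ite_mul, one_mul, zero_mul, mul_ite, mul_one, mul_zero, Finset.sum_ite_eq',
    Finset.sum_ite_eq, Finset.mem_univ, if_true]
  rw [← Equiv.prod_comp σ]
  simp

end TensorPow

/-- the Haar moments -/
noncomputable def EE (t : ℕ) (μ : Measure UG) (i j k l : Fin t → D) : ℂ :=
  ∫ U : UG, tensorPow t (U : Matrix D D ℂ) i k *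
    (starRingEnd ℂ) (tensorPow t (U : Matrix D D ℂ) j l) ∂μ

lemma tensorPow_norm_le (t : ℕ) (U : UG) (i k : Fin t → D) :
    ‖tensorPow t (U : Matrix D D ℂ) i k‖ ≤ 1 := by
  simp only [tensorPow, norm_prod]
  apply Finset.prod_le_one
  · intro a _; positivity
  · intro a _; exact entry_norm_bound_of_unitary U.2 _ _

lemma tensorPow_cont (t : ℕ) (i k : Fin t → D) :
    Continuous fun U : UG => tensorPow t (U : Matrix D D ℂ) i k := by
  simp only [tensorPow]
  apply continuous_finsetProd
  intro a _
  exact continuous_subtype_val.matrix_elem _ _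

lemma EE_int (t : ℕ) (μ : Measure UG) [IsProbabilityMeasure μ] (i j k l : Fin t → D) :
    Integrable (fun U : UG => tensorPow t (U : Matrix D D ℂ) i k *
    (starRingEnd ℂ) (tensorPow t (U : Matrix D D ℂ) j l)) μ := by
  apply Integrable.of_bound (C := 1)
  · apply Continuous.aestronglyMeasurable
    exact (tensorPow_cont t i k).mul (Complex.continuous_conj.comp (tensorPow_cont t j l))
  · filter_upwards with U
    rw [norm_mul, RCLike.norm_conj]
    have h1 := tensorPow_norm_le t U i k
    have h2 := tensorPow_norm_le t U j l
    have := norm_nonneg (tensorPow t (U : Matrix D D ℂ) i k)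
    have := norm_nonneg (tensorPow t (U : Matrix D D ℂ) j l)
    nlinarith

lemma EE_inv (t : ℕ) (μ : Measure UG) [μ.IsHaarMeasure] [IsProbabilityMeasure μ]
    (V : UG) (k l : Fin t → D) :
    tensorPow t (V : Matrix D D ℂ) * (Matrix.of fun i j => EE t μ i j k l) *
      (tensorPow t (V : Matrix D D ℂ))ᴴ = Matrix.of fun i j => EE t μ i j k l := by
  ext i j
  simp only [Matrix.mul_apply, Matrix.of_apply, Matrix.conjTranspose_apply]
  have h := integral_mul_left_eq_self (μ := μ) (fun U : UG => tensorPow t (U : Matrix D D ℂ) i k *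
    (starRingEnd ℂ) (tensorPow t (U : Matrix D D ℂ) j l)) V
  conv_rhs => rw [EE, ← h]
  have h2 : ∀ U : UG, tensorPow t ((V * U : UG) : Matrix D D ℂ) i k *
      (starRingEnd ℂ) (tensorPow t ((V * U : UG) : Matrix D D ℂ) j l) =
      ∑ j', ∑ i', (tensorPow t (V : Matrix D D ℂ) i i' * star (tensorPow t (V : Matrix D D ℂ) j j')) *
        (tensorPow t (U : Matrix D D ℂ) i' k *
        (starRingEnd ℂ) (tensorPow t (U : Matrix D D ℂ) j' l)) := by
    intro U
    have : ((V * U : UG) : Matrix D D ℂ) = (V : Matrix D D ℂ) * (U : Matrix D D ℂ) := rfl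
    rw [this, tensorPow_mul, Matrix.mul_apply, Matrix.mul_apply, map_sum, Finset.sum_mul_sum,
      Finset.sum_comm]
    refine Finset.sum_congr rfl fun j' _ => Finset.sum_congr rfl fun i' _ => ?_
    rw [map_mul]
    simp only [starRingEnd_apply]
    ring
  simp only [h2]
  rw [integral_finsetSum]
  · refine Finset.sum_congr rfl fun j' _ => ?_
    rw [integral_finsetSum, Finset.sum_mul]
    · refine Finset.sum_congr rfl fun i' _ => ?_
      rw [integral_const_mul, EE]
      ring
    · intro i' _
      exact (EE_int t μ _ _ _ _).const_mul _
  · intro j' _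
    apply integrable_finsetSum
    intro i' _
    exact (EE_int t μ _ _ _ _).const_mul _

lemma EE_comm (t : ℕ) (μ : Measure UG) [μ.IsHaarMeasure] [IsProbabilityMeasure μ]
    (V : UG) (k l : Fin t → D) :
    tensorPow t (V : Matrix D D ℂ) * (Matrix.of fun i j => EE t μ i j k l) =
      (Matrix.of fun i j => EE t μ i j k l) * tensorPow t (V : Matrix D D ℂ) := by
  have h := EE_inv t μ V k l
  have h2 : (tensorPow t (V : Matrix D D ℂ))ᴴ * tensorPow t (V : Matrix D D ℂ) = 1 := by
    rw [← tensorPow_conjTranspose, ← tensorPow_mul, ← tensorPow_one]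
    congr 1
    exact Matrix.mem_unitaryGroup_iff'.mp V.2
  conv_rhs => rw [← h]
  rw [Matrix.mul_assoc, h2, Matrix.mul_one]

lemma EE_trace (t : ℕ) (μ : Measure UG) [IsProbabilityMeasure μ]
    (σ : Equiv.Perm (Fin t)) (k l : Fin t → D) :
    ∑ i, ∑ j, RR σ i j * EE t μ i j k l = RR σ k l := by
  have h2 : ∀ U : UG, ∑ i, ∑ j, RR σ i j * (tensorPow t (U : Matrix D D ℂ) i k *
    (starRingEnd ℂ) (tensorPow t (U : Matrix D D ℂ) j l)) = RR σ k l := by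
    intro U
    have h3 : (tensorPow t (U : Matrix D D ℂ))ᴴ * tensorPow t (U : Matrix D D ℂ) = 1 := by
      rw [← tensorPow_conjTranspose, ← tensorPow_mul, ← tensorPow_one]
      congr 1
      exact Matrix.mem_unitaryGroup_iff'.mp U.2
    have h4 : (tensorPow t (U : Matrix D D ℂ))ᴴ * (RR σ)ᵀ * tensorPow t (U : Matrix D D ℂ)
        = (RR σ)ᵀ := by
      have h5 : (RR σ : Matrix (Fin t → D) (Fin t → D) ℂ)ᵀ = RR σ.symm := by
        ext i j
        simp only [RR, Matrix.transpose_apply]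
        congr 1
        apply propext
        constructor
        · rintro rfl; ext a <;> simp
        · rintro rfl; ext a <;> simp
      rw [h5, Matrix.mul_assoc, RR_comm, ← Matrix.mul_assoc, h3, Matrix.one_mul]
    have h6 := congrFun (congrFun h4 l) k
    simp only [Matrix.mul_apply, Matrix.transpose_apply, Matrix.conjTranspose_apply,
      Finset.sum_mul] at h6
    rw [← h6]
    refine Finset.sum_congr rfl fun i _ => Finset.sum_congr rfl fun j _ => ?_
    simp only [starRingEnd_apply]
    ring
  calc _ = ∫ U : UG, ∑ i, ∑ j, RR σ i j * (tensorPow t (U : Matrix D D ℂ) i k *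
    (starRingEnd ℂ) (tensorPow t (U : Matrix D D ℂ) j l)) ∂μ := by
        rw [integral_finsetSum]
        · refine Finset.sum_congr rfl fun i _ => ?_
          rw [integral_finsetSum]
          · refine Finset.sum_congr rfl fun j _ => ?_
            rw [integral_const_mul, EE]
          · intro i' _
            exact (EE_int t μ _ _ _ _).const_mul _
        · intro j' _
          apply integrable_finsetSum
          intro i' _
          exact (EE_int t μ _ _ _ _).const_mul _
    _ = _ := by
      simp only [h2]
      simp

section SchurWeyl

def cnt {t : ℕ} (i : Fin t → D) (d : D) : ℕ := (Finset.univ.filter fun a => i a = d).card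

lemma I_pow_inj {m n : ℕ} (hm : m < 4) (hn : n < 4) (h : Complex.I ^ m = Complex.I ^ n) :
    m = n := by
  have e2 : Complex.I ^ 2 = -1 := Complex.I_sq
  have e3 : Complex.I ^ 3 = -Complex.I := Complex.I_pow_three
  interval_cases m <;> interval_cases n <;> first
    | rfl
    | (exfalso; revert h; simp [e2, e3, Complex.ext_iff]; try norm_num)

lemma diag_unitary (d : D) :
    Matrix.diagonal (fun x : D => if x = d then Complex.I else 1) ∈ Matrix.unitaryGroup D ℂ := by
  rw [Matrix.mem_unitaryGroup_iff, Matrix.star_eq_conjTranspose, Matrix.diagonal_conjTranspose,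
    Matrix.diagonal_mul_diagonal, ← Matrix.diagonal_one]
  congr 1
  ext x
  by_cases h : x = d <;> simp [h]

lemma tensorPow_diagonal {t : ℕ} (z : D → ℂ) :
    tensorPow t (Matrix.diagonal z) = Matrix.diagonal fun i => ∏ a, z (i a) := by
  ext i j
  simp only [tensorPow, Matrix.diagonal_apply]
  by_cases h : i = j
  · subst h; simp
  · rw [if_neg h]
    obtain ⟨a, ha⟩ := Function.ne_iff.mp h
    exact Finset.prod_eq_zero (Finset.mem_univ a) (if_neg ha)

lemma weight {t : ℕ} (ht : t ≤ 3) (X : Matrix (Fin t → D) (Fin t → D) ℂ)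
    (hX : ∀ V : UG, tensorPow t (V : Matrix D D ℂ) * X = X * tensorPow t (V : Matrix D D ℂ))
    (i j : Fin t → D) (h : X i j ≠ 0) (d : D) : cnt i d = cnt j d := by
  have h1 := congrFun (congrFun (hX ⟨_, diag_unitary d⟩) i) j
  simp only [tensorPow_diagonal, Matrix.diagonal_mul, Matrix.mul_diagonal] at h1
  have h2 : ∀ i : Fin t → D, ∏ a, (if i a = d then Complex.I else 1) = Complex.I ^ cnt i d := by
    intro i
    rw [Finset.prod_ite]
    simp [cnt]
  rw [h2, h2, mul_comm] at h1
  have hc : ∀ i : Fin t → D, cnt i d < 4 := by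
    intro i
    have : cnt i d ≤ _ := Finset.card_le_univ _
    rw [Fintype.card_fin] at this
    omega
  exact I_pow_inj (hc i) (hc j) (mul_left_cancel₀ h h1)

theorem schurWeyl {t n : ℕ} (ht : t ≤ 3) (pm : Fin n → Equiv.Perm (Fin t)) (J0 : Fin t → D)
    (hB : ∀ i : Fin t → D, (∀ d, cnt i d = cnt J0 d) → ∃ s, i = J0 ∘ pm s)
    (hC : ∀ s s', J0 ∘ pm s = J0 ∘ pm s' → s = s')
    (hD : ∀ j : Fin t → D, ∃ (V : Matrix D D ℤ) (m : ℤ), m ≠ 0 ∧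
      (∀ x y, ∑ z, V x z * V y z = if x = y then m * m else 0) ∧
      (∏ a, V (j a) (J0 a)) ≠ 0 ∧
      ∀ j' : Fin t → D, (∀ d, cnt j' d = cnt j d) → j' ≠ j → ∏ a, V (j' a) (J0 a) = 0)
    (X : Matrix (Fin t → D) (Fin t → D) ℂ)
    (hX : ∀ V : UG, tensorPow t (V : Matrix D D ℂ) * X = X * tensorPow t (V : Matrix D D ℂ)) :
    ∃ c : Fin n → ℂ, ∀ i j, X i j = ∑ s, c s * RR (pm s) i j := by
  refine ⟨fun s => X (J0 ∘ pm s) J0, ?_⟩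
  set Y : Matrix (Fin t → D) (Fin t → D) ℂ := X - ∑ s, X (J0 ∘ pm s) J0 • RR (pm s) with hY
  have hYc : ∀ V : UG, tensorPow t (V : Matrix D D ℂ) * Y = Y * tensorPow t (V : Matrix D D ℂ) := by
    intro V
    rw [hY, Matrix.mul_sub, Matrix.sub_mul, hX V, Matrix.mul_sum, Matrix.sum_mul]
    congr 1
    refine Finset.sum_congr rfl fun s _ => ?_
    rw [Matrix.mul_smul, Matrix.smul_mul, RR_comm]
  have hYapp : ∀ i j, Y i j = X i j - ∑ s, X (J0 ∘ pm s) J0 * RR (pm s) i j := by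
    intro i j
    rw [hY, Matrix.sub_apply, Matrix.sum_apply]
    simp
  have hY0 : ∀ i, Y i J0 = 0 := by
    intro i
    by_contra hne
    obtain ⟨s, rfl⟩ := hB i (weight ht Y hYc i J0 hne)
    apply hne
    rw [hYapp, Finset.sum_eq_single s]
    · simp [RR]
    · intro s' _ hs'
      have : ¬ (J0 ∘ pm s = J0 ∘ pm s') := fun h => hs' (hC _ _ h).symm
      simp [RR, this]
    · simp
  have hY1 : ∀ i j, Y i j = 0 := by
    intro i j
    by_contra hne
    have hw := weight ht Y hYc i j hne
    obtain ⟨V, m, hm, hV, hn, hz⟩ := hD j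
    have hmC : (m : ℂ) ≠ 0 := by exact_mod_cast hm
    have hU : (Matrix.of fun x y => (V x y : ℂ) / m) ∈ Matrix.unitaryGroup D ℂ := by
      rw [Matrix.mem_unitaryGroup_iff, Matrix.star_eq_conjTranspose]
      ext x y
      simp only [Matrix.mul_apply, Matrix.conjTranspose_apply, Matrix.of_apply, Matrix.one_apply]
      have h1 : ∑ z, (V x z : ℂ) * (V y z : ℂ) = if x = y then (m : ℂ) * m else 0 := by
        have := congrArg (fun q : ℤ => (q : ℂ)) (hV x y)
        push_cast at this
        exact this
      have h2 : ∀ z, (V x z : ℂ) / m * star ((V y z : ℂ) / m) =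
          ((V x z : ℂ) * (V y z : ℂ)) / (m * m) := by
        intro z
        simp only [star_div₀, Complex.star_def, map_intCast]
        rw [div_mul_div_comm]
      simp only [h2]
      rw [← Finset.sum_div, h1]
      split_ifs <;> simp [hmC]
    have h1 := congrFun (congrFun (hYc ⟨_, hU⟩) i) J0
    simp only [Matrix.mul_apply, hY0, mul_zero, Finset.sum_const_zero] at h1
    rw [Finset.sum_eq_single j] at h1
    · have h3 : tensorPow t (Matrix.of fun x y => (V x y : ℂ) / m) j J0 ≠ 0 := by
        simp only [tensorPow, Matrix.of_apply]
        rw [Finset.prod_div_distrib]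
        apply div_ne_zero
        · exact_mod_cast hn
        · simp [hmC]
      exact (mul_ne_zero hne h3) h1.symm
    · intro j' _ hj'
      by_cases hYj : Y i j' = 0
      · rw [hYj, zero_mul]
      · have hw' := weight ht Y hYc i j' hYj
        have h4 := hz j' (fun d => by rw [← hw' d, hw d]) hj'
        have h3 : tensorPow t (Matrix.of fun x y => (V x y : ℂ) / m) j' J0 = 0 := by
          simp only [tensorPow, Matrix.of_apply]
          rw [Finset.prod_div_distrib]
          have : ∏ a, (V (j' a) (J0 a) : ℂ) = 0 := by exact_mod_cast h4
          rw [this, zero_div]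
        rw [h3, mul_zero]
    · simp
  intro i j
  have := hY1 i j
  rw [hYapp, sub_eq_zero] at this
  exact this

/-- The Weingarten formula. -/
theorem weingarten {t n : ℕ} (μ : Measure UG) [μ.IsHaarMeasure] [IsProbabilityMeasure μ]
    (pm : Fin n → Equiv.Perm (Fin t))
    (hSW : ∀ X : Matrix (Fin t → D) (Fin t → D) ℂ,
      (∀ V : UG, tensorPow t (V : Matrix D D ℂ) * X = X * tensorPow t (V : Matrix D D ℂ)) →
      ∃ c : Fin n → ℂ, ∀ i j, X i j = ∑ s, c s * RR (pm s) i j)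
    (Wg : Fin n → Fin n → ℂ)
    (hW : ∀ s s', ∑ p, Wg s p * (∑ i : Fin t → D, ∑ j, RR (pm p) i j * RR (pm s') i j) =
      if s = s' then 1 else 0)
    (i j k l : Fin t → D) :
    EE t μ i j k l = ∑ s, ∑ p, Wg s p * RR (pm s) i j * RR (pm p) k l := by
  obtain ⟨c, hc⟩ := hSW (Matrix.of fun i j => EE t μ i j k l) (fun V => EE_comm t μ V k l)
  simp only [Matrix.of_apply] at hc
  have h1 : ∀ p, RR (pm p) k l =
      ∑ s, c s * (∑ i : Fin t → D, ∑ j, RR (pm p) i j * RR (pm s) i j) := by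
    intro p
    rw [← EE_trace t μ (pm p) k l]
    simp only [hc, Finset.mul_sum]
    conv_rhs => rw [Finset.sum_comm]
    conv_rhs => enter [2, i]; rw [Finset.sum_comm]
    refine Finset.sum_congr rfl fun i _ => Finset.sum_congr rfl fun j _ =>
      Finset.sum_congr rfl fun s _ => ?_
    ring
  have h2 : ∀ s, c s = ∑ p, Wg s p * RR (pm p) k l := by
    intro s
    simp only [h1, Finset.mul_sum]
    rw [Finset.sum_comm]
    have : ∀ s', ∑ p, ∑ i : Fin t → D, ∑ j, Wg s p * (c s' * (RR (pm p) i j * RR (pm s') i j)) =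
        c s' * if s = s' then 1 else 0 := by
      intro s'
      rw [← hW s s', Finset.mul_sum]
      refine Finset.sum_congr rfl fun p _ => ?_
      simp only [Finset.mul_sum]
      refine Finset.sum_congr rfl fun i _ => Finset.sum_congr rfl fun j _ => ?_
      ring
    simp only [this]
    simp
  rw [hc]
  refine Finset.sum_congr rfl fun s _ => ?_
  rw [h2, Finset.sum_mul]
  refine Finset.sum_congr rfl fun p _ => ?_
  ring

end SchurWeyl

section Spectral

variable {A : Type*} [Fintype A] {n : ℕ}

/-- projector on sites 1,2 -/
def PP (r : Fin n → A → ℂ) (Wg : Fin n → Fin n → ℂ) :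
    (A → A → A → ℂ) →ₗ[ℂ] (A → A → A → ℂ) where
  toFun u := fun s1 s2 s3 => ∑ s, ∑ p, Wg s p * (r s s1 * r s s2) *
    ∑ a, ∑ b, r p a * r p b * u a b s3
  map_add' u v := by
    funext s1 s2 s3
    simp only [Pi.add_apply, mul_add, Finset.sum_add_distrib]
  map_smul' c u := by
    funext s1 s2 s3
    simp only [Pi.smul_apply, smul_eq_mul, RingHom.id_apply, Finset.mul_sum]
    refine Finset.sum_congr rfl fun _ _ => Finset.sum_congr rfl fun _ _ =>
      Finset.sum_congr rfl fun _ _ => Finset.sum_congr rfl fun _ _ => ?_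
    ring

/-- reflection -/
def reflL (A : Type*) : (A → A → A → ℂ) →ₗ[ℂ] (A → A → A → ℂ) where
  toFun u := fun s1 s2 s3 => u s3 s2 s1
  map_add' u v := rfl
  map_smul' c u := rfl

lemma refl_refl (u : A → A → A → ℂ) : reflL A (reflL A u) = u := rfl

/-- product vector -/
def R3 (f g h : A → ℂ) : A → A → A → ℂ := fun a b c => f a * g b * h c

lemma refl_R3 (f g h : A → ℂ) : reflL A (R3 f g h) = R3 h g f := by
  funext a b c
  simp only [reflL, R3, LinearMap.coe_mk, AddHom.coe_mk]
  ring

/-- projector on sites 2,3 -/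
def QQ (r : Fin n → A → ℂ) (Wg : Fin n → Fin n → ℂ) :
    (A → A → A → ℂ) →ₗ[ℂ] (A → A → A → ℂ) := reflL A ∘ₗ PP r Wg ∘ₗ reflL A

lemma PP_R3 (r : Fin n → A → ℂ) (Wg : Fin n → Fin n → ℂ) (f g h : A → ℂ) :
    PP r Wg (R3 f g h) = ∑ s, (∑ p, Wg s p * (∑ a, r p a * f a) * (∑ b, r p b * g b)) •
      R3 (r s) (r s) h := by
  funext s1 s2 s3
  simp only [PP, R3, LinearMap.coe_mk, AddHom.coe_mk, Finset.sum_apply, Pi.smul_apply, smul_eq_mul]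
  refine Finset.sum_congr rfl fun s _ => ?_
  rw [Finset.sum_mul]
  refine Finset.sum_congr rfl fun p _ => ?_
  have : ∑ a, ∑ b, r p a * r p b * (f a * g b * h s3) =
      (∑ a, r p a * f a) * (∑ b, r p b * g b) * h s3 := by
    rw [Finset.sum_mul_sum, Finset.sum_mul]
    refine Finset.sum_congr rfl fun a _ => ?_
    rw [Finset.sum_mul]
    refine Finset.sum_congr rfl fun b _ => ?_
    ring
  rw [this]
  ring

lemma PP_form (r : Fin n → A → ℂ) (Wg : Fin n → Fin n → ℂ) (u : A → A → A → ℂ) :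
    ∃ w : Fin n → A → ℂ, PP r Wg u = ∑ s, R3 (r s) (r s) (w s) := by
  refine ⟨fun s c => ∑ p, Wg s p * ∑ a, ∑ b, r p a * r p b * u a b c, ?_⟩
  funext s1 s2 s3
  simp only [PP, R3, LinearMap.coe_mk, AddHom.coe_mk, Finset.sum_apply, Finset.mul_sum]
  refine Finset.sum_congr rfl fun _ _ => Finset.sum_congr rfl fun _ _ =>
      Finset.sum_congr rfl fun _ _ => Finset.sum_congr rfl fun _ _ => ?_
  ring

variable (r : Fin n → A → ℂ) (Wg : Fin n → Fin n → ℂ) (M : Fin n → Fin n → Fin n → ℂ)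

lemma PP_rr
    (hM : ∀ d x y, ∑ p, Wg d p * (∑ a, r p a * r x a) * (∑ b, r p b * r y b) = M d x y) (x y : Fin n) (h : A → ℂ) :
    PP r Wg (R3 (r x) (r y) h) = ∑ d, M d x y • R3 (r d) (r d) h := by
  rw [PP_R3]
  simp only [hM]

lemma QQ_rr
    (hM : ∀ d x y, ∑ p, Wg d p * (∑ a, r p a * r x a) * (∑ b, r p b * r y b) = M d x y) (x y : Fin n) (h : A → ℂ) :
    QQ r Wg (R3 h (r y) (r x)) = ∑ d, M d x y • R3 h (r d) (r d) := by
  simp only [QQ, LinearMap.comp_apply, refl_R3, PP_rr r Wg M hM, map_sum, map_smul]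

lemma PP_idem
    (hM : ∀ d x y, ∑ p, Wg d p * (∑ a, r p a * r x a) * (∑ b, r p b * r y b) = M d x y)
    (hMd : ∀ d x, M d x x = if d = x then 1 else 0) (u : A → A → A → ℂ) : PP r Wg (PP r Wg u) = PP r Wg u := by
  obtain ⟨w, hw⟩ := PP_form r Wg u
  rw [hw, map_sum]
  refine Finset.sum_congr rfl fun s _ => ?_
  rw [PP_rr r Wg M hM]
  simp [hMd]

lemma QQ_idem
    (hM : ∀ d x y, ∑ p, Wg d p * (∑ a, r p a * r x a) * (∑ b, r p b * r y b) = M d x y)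
    (hMd : ∀ d x, M d x x = if d = x then 1 else 0) (u : A → A → A → ℂ) : QQ r Wg (QQ r Wg u) = QQ r Wg u := by
  simp only [QQ, LinearMap.comp_apply, refl_refl, PP_idem r Wg M hM hMd]

lemma QP_form (u : A → A → A → ℂ) :
    ∃ b : Fin n → Fin n → ℂ, QQ r Wg (PP r Wg u) = ∑ x, ∑ y, b x y • R3 (r x) (r y) (r y) := by
  obtain ⟨w, hw⟩ := PP_form r Wg u
  refine ⟨fun s d => ∑ p, Wg d p * (∑ a, r p a * w s a) * (∑ b, r p b * r s b), ?_⟩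
  rw [hw, map_sum]
  refine Finset.sum_congr rfl fun s _ => ?_
  simp only [QQ, LinearMap.comp_apply, refl_R3]
  rw [PP_R3, map_sum]
  simp only [map_smul, refl_R3]

/-- shifted transfer operator -/
def TT (lam : ℂ) (u : A → A → A → ℂ) : A → A → A → ℂ := QQ r Wg (PP r Wg u) - lam • u

lemma TT_smul (lam c : ℂ) (u : A → A → A → ℂ) : TT r Wg lam (c • u) = c • TT r Wg lam u := by
  simp only [TT, map_smul, smul_sub, smul_comm c lam]

lemma TT_sum {ι : Type*} (S : Finset ι) (lam : ℂ) (u : ι → A → A → A → ℂ) :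
    TT r Wg lam (∑ i ∈ S, u i) = ∑ i ∈ S, TT r Wg lam (u i) := by
  simp only [TT, map_sum, Finset.smul_sum, Finset.sum_sub_distrib]

theorem upper
    (hM : ∀ d x y, ∑ p, Wg d p * (∑ a, r p a * r x a) * (∑ b, r p b * r y b) = M d x y)
    (hMd : ∀ d x, M d x x = if d = x then 1 else 0)
    (hann : ∀ x y, TT r Wg 0 (TT r Wg 1 (TT r Wg (4/25) (TT r Wg (1/25) (TT r Wg (1/100)
      (R3 (r x) (r y) (r y)))))) = 0)
    (x : ℝ) (v : A → A → A → ℂ) (hv : v ≠ 0)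
    (h : (1/2 : ℂ) • (PP r Wg v + QQ r Wg v) = (x : ℂ) • v) : x = 1 ∨ x ≤ 7/10 := by
  by_contra hcon
  push Not at hcon
  obtain ⟨hx1, hx2⟩ := hcon
  set p := PP r Wg v with hp
  set q := QQ r Wg v with hq
  have hpp : PP r Wg p = p := PP_idem r Wg M hM hMd v
  have hqq : QQ r Wg q = q := QQ_idem r Wg M hM hMd v
  have h1 : p + q = (2 * x : ℂ) • v := by
    rw [mul_smul, ← h, smul_smul]; norm_num
  have hPq : PP r Wg q = (2 * x - 1 : ℂ) • p := by
    have := congrArg (PP r Wg) h1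
    rw [map_add, map_smul, hpp, ← hp] at this
    rw [sub_smul, one_smul, ← this]; abel
  have hQp : QQ r Wg p = (2 * x - 1 : ℂ) • q := by
    have := congrArg (QQ r Wg) h1
    rw [map_add, map_smul, hqq, ← hq] at this
    rw [sub_smul, one_smul, ← this]; abel
  have hc0 : (2 * x - 1 : ℂ) ≠ 0 := by
    intro h0
    have : (2 * x - 1 : ℝ) = 0 := by exact_mod_cast h0
    linarith
  have hq0 : q ≠ 0 := by
    intro h0
    rw [h0, map_zero] at hPq
    have hp0 : p = 0 := by
      rcases smul_eq_zero.mp hPq.symm with h | h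
      · exact absurd h hc0
      · exact h
    rw [hp0, h0, add_zero] at h1
    rcases smul_eq_zero.mp h1.symm with h | h
    · have : (2 * x : ℝ) = 0 := by exact_mod_cast h
      linarith
    · exact hv h
  have hT : ∀ lam, TT r Wg lam q = (((2 * x - 1)^2 : ℂ) - lam) • q := by
    intro lam
    rw [TT, hPq, map_smul, hQp, smul_smul, sub_smul, sq]
  have hz : TT r Wg 0 (TT r Wg 1 (TT r Wg (4/25) (TT r Wg (1/25) (TT r Wg (1/100) q)))) = 0 := by
    obtain ⟨b, hb⟩ := QP_form r Wg q
    have hqb : q = (((2 * x - 1)^2)⁻¹ : ℂ) • ∑ x, ∑ y, b x y • R3 (r x) (r y) (r y) := by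
      rw [← hb, hPq, map_smul, hQp, smul_smul, smul_smul, mul_assoc, ← sq, inv_mul_cancel₀ (pow_ne_zero 2 hc0),
        one_smul]
    rw [hqb]
    simp only [TT_smul, TT_sum, hann, smul_zero, Finset.sum_const_zero]
  simp only [hT, TT_smul, smul_smul] at hz
  have hz2 := (smul_eq_zero.mp hz).resolve_right hq0
  have hz3 : (((((2 * x - 1)^2 - 1/100) * ((2 * x - 1)^2 - 1/25)) * ((2 * x - 1)^2 - 4/25))
      * ((2 * x - 1)^2 - 1)) * ((2 * x - 1)^2 - 0) = (0 : ℝ) := by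
    apply Complex.ofReal_injective
    push_cast
    exact hz2
  have hy : 4/25 < (2 * x - 1)^2 := by nlinarith
  rcases mul_eq_zero.mp hz3 with hz3 | hz3
  · rcases mul_eq_zero.mp hz3 with hz3 | hz3
    · rcases mul_eq_zero.mp hz3 with hz3 | hz3
      · rcases mul_eq_zero.mp hz3 with hz3 | hz3 <;> linarith
      · linarith
    · have : (x - 1) * x = 0 := by nlinarith
      rcases mul_eq_zero.mp this with h | h
      · exact hx1 (by linarith)
      · linarith
  · linarith

theorem lower
    (hM : ∀ d x y, ∑ p, Wg d p * (∑ a, r p a * r x a) * (∑ b, r p b * r y b) = M d x y)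
    (hMd : ∀ d x, M d x x = if d = x then 1 else 0) (e s : Fin n)
    (h1 : ∀ d, M d e s = if d = e ∨ d = s then 2/5 else 0)
    (h2 : ∀ d, M d s e = if d = e ∨ d = s then 2/5 else 0) (hes : e ≠ s)
    (a : A) (ha : r e a = 1) (hb : r s a = 0) :
    ∃ v, v ≠ 0 ∧ (1/2 : ℂ) • (PP r Wg v + QQ r Wg v) = ((7/10 : ℝ) : ℂ) • v := by
  have key : ∀ x y : Fin n, (∀ d, M d x y = if d = e ∨ d = s then 2/5 else 0) → ∀ F : Fin n → A → A → A → ℂ,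
      ∑ d, M d x y • F d = (2/5 : ℂ) • (F e + F s) := by
    intro x y hxy F
    simp only [hxy, ite_smul, zero_smul]
    rw [← Finset.sum_filter]
    have : (Finset.univ.filter fun d => d = e ∨ d = s) = {e, s} := by ext; simp
    rw [this, Finset.sum_pair hes, smul_add]
  have keyd : ∀ x : Fin n, ∀ F : Fin n → A → A → A → ℂ,
      ∑ d, M d x x • F d = F x := by
    intro x F
    simp [hMd]
  refine ⟨R3 (r e) (r s) (r s) + R3 (r s) (r e) (r e) + R3 (r s) (r s) (r e) + R3 (r e) (r e) (r s)
    - (4/3 : ℂ) • (R3 (r e) (r e) (r e) + R3 (r s) (r s) (r s)), ?_, ?_⟩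
  · intro h
    have := congrFun (congrFun (congrFun h a) a) a
    simp [R3, ha, hb] at this
  · simp only [map_sub, map_add, map_smul, PP_rr r Wg M hM, QQ_rr r Wg M hM, key _ _ h1, key _ _ h2,
      keyd]
    funext a b c
    simp only [Pi.smul_apply, Pi.add_apply, Pi.sub_apply, smul_eq_mul]
    push_cast
    ring

/-- integer coefficient vectors -/
def LL (b : Fin n → Fin n → ℤ) : A → A → A → ℂ := ∑ x, ∑ y, (b x y : ℂ) • R3 (r x) (r y) (r y)

/-- integer transfer matrix, scaled by 100 -/
def Tz (Mz : Fin n → Fin n → Fin n → ℤ) (lam : ℤ) (b : Fin n → Fin n → ℤ) : Fin n → Fin n → ℤ :=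
  fun d e => (∑ y, Mz e d y * ∑ x, Mz d x y * b x y) - lam * b d e

lemma TT_LL
    (hM : ∀ d x y, ∑ p, Wg d p * (∑ a, r p a * r x a) * (∑ b, r p b * r y b) = M d x y) (Mz : Fin n → Fin n → Fin n → ℤ) (hsym : ∀ d x y, Mz d x y = Mz d y x)
    (hMz : ∀ d x y, M d x y = (Mz d x y : ℂ) / 10)
    (lam : ℤ) (b : Fin n → Fin n → ℤ) :
    TT r Wg (lam / 100) (LL r b) = (1/100 : ℂ) • LL r (Tz Mz lam b) := by
  have h1 : QQ r Wg (PP r Wg (LL r b)) = ∑ x, ∑ y, ∑ d, ∑ e,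
      ((b x y : ℂ) * M d x y * M e d y) • R3 (r d) (r e) (r e) := by
    simp only [LL, map_sum, map_smul, PP_rr r Wg M hM, QQ_rr r Wg M hM, Finset.smul_sum, smul_smul]
    refine Finset.sum_congr rfl fun x _ => Finset.sum_congr rfl fun y _ =>
      Finset.sum_congr rfl fun d _ => Finset.sum_congr rfl fun e _ => ?_
    rw [hMz e d y, hMz e y d, hsym e d y]
  have h2 : ∑ x, ∑ y, ∑ d, ∑ e, ((b x y : ℂ) * M d x y * M e d y) • R3 (r d) (r e) (r e)
      = ∑ d, ∑ e, (∑ y, ∑ x, (b x y : ℂ) * M d x y * M e d y) • R3 (r d) (r e) (r e) := by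
    simp only [Finset.sum_smul]
    rw [Finset.sum_comm]
    conv_lhs => enter [2, y]; rw [Finset.sum_comm]
    rw [Finset.sum_comm]
    refine Finset.sum_congr rfl fun d _ => ?_
    conv_lhs => enter [2, y]; rw [Finset.sum_comm]
    rw [Finset.sum_comm]
  rw [TT, h1, h2]
  simp only [LL, Finset.smul_sum, smul_smul, ← Finset.sum_sub_distrib, ← sub_smul]
  refine Finset.sum_congr rfl fun d _ => Finset.sum_congr rfl fun e _ => ?_
  congr 1
  simp only [Tz, hMz]
  push_cast
  rw [mul_sub]
  congr 1
  · simp only [Finset.mul_sum]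
    refine Finset.sum_congr rfl fun _ _ => Finset.sum_congr rfl fun _ _ => ?_
    ring
  · ring

lemma ann
    (hM : ∀ d x y, ∑ p, Wg d p * (∑ a, r p a * r x a) * (∑ b, r p b * r y b) = M d x y) (Mz : Fin n → Fin n → Fin n → ℤ) (hsym : ∀ d x y, Mz d x y = Mz d y x)
    (hMz : ∀ d x y, M d x y = (Mz d x y : ℂ) / 10)
    (hz : ∀ x y, Tz Mz 0 (Tz Mz 100 (Tz Mz 16 (Tz Mz 4 (Tz Mz 1
      (fun d e => if d = x ∧ e = y then 1 else 0))))) = fun _ _ => 0) (x y : Fin n) :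
    TT r Wg 0 (TT r Wg 1 (TT r Wg (4/25) (TT r Wg (1/25) (TT r Wg (1/100)
      (R3 (r x) (r y) (r y)))))) = 0 := by
  have h := TT_LL r Wg M hM Mz hsym hMz
  have hR : R3 (r x) (r y) (r y) = LL r (fun d e => if d = x ∧ e = y then 1 else 0) := by
    rw [LL, Finset.sum_eq_single x, Finset.sum_eq_single y] <;> simp +contextual
  have e0 : (0 : ℂ) = ((0 : ℤ) : ℂ) / 100 := by norm_num
  have e1 : (1 : ℂ) = ((100 : ℤ) : ℂ) / 100 := by norm_num
  have e2 : (4/25 : ℂ) = ((16 : ℤ) : ℂ) / 100 := by norm_num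
  have e3 : (1/25 : ℂ) = ((4 : ℤ) : ℂ) / 100 := by norm_num
  have e4 : (1/100 : ℂ) = ((1 : ℤ) : ℂ) / 100 := by norm_num
  have h0 := fun b => h 0 b
  have h1 := fun b => h 100 b
  have h2 := fun b => h 16 b
  have h3 := fun b => h 4 b
  have h4 := fun b => h 1 b
  rw [← e0] at h0
  rw [← e1] at h1
  rw [← e2] at h2
  rw [← e3] at h3
  rw [← e4] at h4
  rw [hR]
  simp only [h4, TT_smul, h3, h2, h1, h0, hz]
  simp [LL]

end Spectral

section Bridge

abbrev Site (t : ℕ) := (Fin t → Fin 2) × (Fin t → Fin 2)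
abbrev Idx (t : ℕ) := (Fin t → Fin 3 → Fin 2) × (Fin t → Fin 3 → Fin 2)

def mk3 {t : ℕ} (a b c : Fin t → Fin 2) : Fin t → Fin 3 → Fin 2 := fun m => ![a m, b m, c m]
def pair {t : ℕ} (a b : Fin t → Fin 2) : Fin t → D := fun m => (a m, b m)

def eqv (t : ℕ) : Site t × Site t × Site t ≃ Idx t where
  toFun s := (mk3 s.1.1 s.2.1.1 s.2.2.1, mk3 s.1.2 s.2.1.2 s.2.2.2)
  invFun p := ((fun m => p.1 m 0, fun m => p.2 m 0), (fun m => p.1 m 1, fun m => p.2 m 1),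
    (fun m => p.1 m 2, fun m => p.2 m 2))
  left_inv s := by simp [mk3]
  right_inv p := by
    apply Prod.ext <;>
    · funext m k
      fin_cases k <;> rfl

def toH {t : ℕ} (v : Idx t → ℂ) : Site t → Site t → Site t → ℂ :=
  fun s1 s2 s3 => v (eqv t (s1, s2, s3))

lemma toH_inj {t : ℕ} {v w : Idx t → ℂ} (h : toH v = toH w) : v = w := by
  funext p
  have := congrFun (congrFun (congrFun h ((eqv t).symm p).1) ((eqv t).symm p).2.1)
    ((eqv t).symm p).2.2
  simpa [toH] using this

def ofH {t : ℕ} (u : Site t → Site t → Site t → ℂ) : Idx t → ℂ :=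
  fun p => u ((eqv t).symm p).1 ((eqv t).symm p).2.1 ((eqv t).symm p).2.2

lemma toH_ofH {t : ℕ} (u : Site t → Site t → Site t → ℂ) : toH (ofH u) = u := by
  funext a b c
  simp [toH, ofH]

lemma tp12 {t : ℕ} (U : Matrix D D ℂ) (x1 x2 x3 y1 y2 y3 : Fin t → Fin 2) :
    tensorPow t (gate12 U) (mk3 x1 x2 x3) (mk3 y1 y2 y3) =
      tensorPow t U (pair x1 x2) (pair y1 y2) * if x3 = y3 then 1 else 0 := by
  simp only [tensorPow, gate12, mk3, pair, Finset.prod_mul_distrib]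
  congr 1
  change (∏ m, if x3 m = y3 m then (1 : ℂ) else 0) = _
  rw [Finset.prod_ite_zero]
  simp [funext_iff]

lemma tp23 {t : ℕ} (U : Matrix D D ℂ) (x1 x2 x3 y1 y2 y3 : Fin t → Fin 2) :
    tensorPow t (gate23 U) (mk3 x1 x2 x3) (mk3 y1 y2 y3) =
      tensorPow t U (pair x2 x3) (pair y2 y3) * if x1 = y1 then 1 else 0 := by
  simp only [tensorPow, gate23, mk3, pair, Finset.prod_mul_distrib]
  congr 1
  change (∏ m, if x1 m = y1 m then (1 : ℂ) else 0) = _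
  rw [Finset.prod_ite_zero]
  simp [funext_iff]

lemma P12_entry {t : ℕ} (μ : Measure UG) (s1 s2 s3 a b c : Site t) :
    P12 t μ (eqv t (s1, s2, s3)) (eqv t (a, b, c)) =
      EE t μ (pair s1.1 s2.1) (pair s1.2 s2.2) (pair a.1 b.1) (pair a.2 b.2) *
        if s3 = c then 1 else 0 := by
  simp only [P12, eqv, Equiv.coe_fn_mk, Matrix.kroneckerMap_apply, Matrix.map_apply, tp12, EE]
  rw [← integral_mul_const]
  congr 1
  funext U
  by_cases h1 : s3.1 = c.1 <;> by_cases h2 : s3.2 = c.2 <;> simp [h1, h2, Prod.ext_iff]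

lemma P23_entry {t : ℕ} (μ : Measure UG) (s1 s2 s3 a b c : Site t) :
    P23 t μ (eqv t (s1, s2, s3)) (eqv t (a, b, c)) =
      EE t μ (pair s2.1 s3.1) (pair s2.2 s3.2) (pair b.1 c.1) (pair b.2 c.2) *
        if s1 = a then 1 else 0 := by
  simp only [P23, eqv, Equiv.coe_fn_mk, Matrix.kroneckerMap_apply, Matrix.map_apply, tp23, EE]
  rw [← integral_mul_const]
  congr 1
  funext U
  by_cases h1 : s1.1 = a.1 <;> by_cases h2 : s1.2 = a.2 <;> simp [h1, h2, Prod.ext_iff]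

lemma RR_pair {t : ℕ} (σ : Equiv.Perm (Fin t)) (x1 x2 y1 y2 : Fin t → Fin 2) :
    RR σ (pair x1 x2) (pair y1 y2) = RR σ x1 y1 * RR σ x2 y2 := by
  have : pair x1 x2 = pair y1 y2 ∘ σ ↔ x1 = y1 ∘ σ ∧ x2 = y2 ∘ σ := by
    simp [funext_iff, pair, forall_and]
  simp only [RR, this]
  by_cases h1 : x1 = y1 ∘ σ <;> by_cases h2 : x2 = y2 ∘ σ <;> simp [h1, h2]

variable {t n : ℕ} (μ : Measure UG) (pm : Fin n → Equiv.Perm (Fin t)) (Wg : Fin n → Fin n → ℂ)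

/-- site permutation vectors -/
def rr (pm : Fin n → Equiv.Perm (Fin t)) : Fin n → Site t → ℂ := fun s x => RR (pm s) x.1 x.2

lemma sum3 {B : Type*} [Fintype B] (F : B × B × B → ℂ) :
    ∑ q, F q = ∑ a, ∑ b, ∑ c, F (a, b, c) := by
  rw [Fintype.sum_prod_type]
  refine Finset.sum_congr rfl fun a _ => ?_
  rw [Fintype.sum_prod_type]

lemma sum4 {B C : Type*} [Fintype B] [Fintype C] (F : B → B → C → C → ℂ) :
    ∑ a, ∑ b, ∑ s, ∑ p, F a b s p = ∑ s, ∑ p, ∑ a, ∑ b, F a b s p := by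
  conv_lhs => enter [2, a]; rw [Finset.sum_comm]
  rw [Finset.sum_comm]
  refine Finset.sum_congr rfl fun s _ => ?_
  conv_lhs => enter [2, a]; rw [Finset.sum_comm]
  rw [Finset.sum_comm]

lemma sum_pair' (F : (Fin t → D) → ℂ) : ∑ i, F i = ∑ x, ∑ y, F (pair x y) := by
  rw [← Equiv.sum_comp (Equiv.arrowProdEquivProdArrow (Fin t) (fun _ => Fin 2) (fun _ => Fin 2)).symm,
    Fintype.sum_prod_type]
  rfl

lemma sum_fact {B : Type*} [Fintype B] (F G : B → B → ℂ) :
    (∑ a, ∑ b, F a b) * (∑ c, ∑ d, G c d) = ∑ a, ∑ c, ∑ b, ∑ d, F a b * G c d := by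
  simp only [Finset.sum_mul_sum]

lemma bridge12
    (hE : ∀ i j k l, EE t μ i j k l = ∑ s, ∑ p, Wg s p * RR (pm s) i j * RR (pm p) k l)
    (v : Idx t → ℂ) : toH ((P12 t μ).mulVec v) = PP (rr pm) Wg (toH v) := by
  funext s1 s2 s3
  simp only [toH, Matrix.mulVec, dotProduct]
  rw [← Equiv.sum_comp (eqv t), sum3]
  simp only [P12_entry, mul_ite, mul_one, mul_zero, ite_mul, zero_mul, Finset.sum_ite_eq,
    Finset.mem_univ, if_true]
  simp only [hE, RR_pair, PP, LinearMap.coe_mk, AddHom.coe_mk, rr, Finset.sum_mul, Finset.mul_sum]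
  rw [sum4]
  refine Finset.sum_congr rfl fun s _ => Finset.sum_congr rfl fun p _ =>
    Finset.sum_congr rfl fun a _ => Finset.sum_congr rfl fun b _ => ?_
  simp only [toH]
  ring

lemma bridge23
    (hE : ∀ i j k l, EE t μ i j k l = ∑ s, ∑ p, Wg s p * RR (pm s) i j * RR (pm p) k l)
    (v : Idx t → ℂ) : toH ((P23 t μ).mulVec v) = QQ (rr pm) Wg (toH v) := by
  funext s1 s2 s3
  simp only [toH, Matrix.mulVec, dotProduct]
  rw [← Equiv.sum_comp (eqv t), sum3, Finset.sum_comm]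
  conv_lhs => enter [2, b]; rw [Finset.sum_comm]
  rw [Finset.sum_comm]
  simp only [P23_entry, mul_ite, mul_one, mul_zero, ite_mul, zero_mul, Finset.sum_ite_eq,
    Finset.mem_univ, if_true]
  simp only [hE, RR_pair, QQ, reflL, PP, LinearMap.comp_apply, LinearMap.coe_mk, AddHom.coe_mk, rr,
    Finset.sum_mul, Finset.mul_sum]
  rw [sum4]
  refine Finset.sum_congr rfl fun s _ => Finset.sum_congr rfl fun p _ =>
    Finset.sum_congr rfl fun a _ => Finset.sum_congr rfl fun b _ => ?_
  simp only [toH]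
  ring

/-- everything assembled from finite data -/
theorem assemble [μ.IsHaarMeasure] [IsProbabilityMeasure μ]
    (hSW : ∀ X : Matrix (Fin t → D) (Fin t → D) ℂ,
      (∀ V : UG, tensorPow t (V : Matrix D D ℂ) * X = X * tensorPow t (V : Matrix D D ℂ)) →
      ∃ c : Fin n → ℂ, ∀ i j, X i j = ∑ s, c s * RR (pm s) i j)
    (gz : Fin n → Fin n → ℕ)
    (hgz : ∀ s p, (Finset.univ.filter fun y : Fin t → Fin 2 => y ∘ pm s = y ∘ pm p).card = gz s p)
    (Wz : Fin n → Fin n → ℤ) (Mz : Fin n → Fin n → Fin n → ℤ)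
    (hMz : ∀ d x y, ∑ p, Wz d p * gz p x * gz p y = 72 * Mz d x y)
    (hMd : ∀ d x, Mz d x x = if d = x then 10 else 0)
    (hsym : ∀ d x y, Mz d x y = Mz d y x)
    (hz : ∀ x y, Tz Mz 0 (Tz Mz 100 (Tz Mz 16 (Tz Mz 4 (Tz Mz 1
      (fun d e => if d = x ∧ e = y then 1 else 0))))) = fun _ _ => 0)
    (e s : Fin n) (hes : e ≠ s)
    (h1 : ∀ d, Mz d e s = if d = e ∨ d = s then 4 else 0)
    (y : Fin t → Fin 2) (he : pm e = 1) (hs : y ≠ y ∘ pm s) :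
    (∀ x : ℝ,
      (∃ v, v ≠ 0 ∧
          ((1 / 2 : ℂ) • (P12 t μ + P23 t μ)).mulVec v = (x : ℂ) • v) →
        x = 1 ∨ x ≤ 7 / 10) ∧
    (∃ v, v ≠ 0 ∧
      ((1 / 2 : ℂ) • (P12 t μ + P23 t μ)).mulVec v = ((7 / 10 : ℝ) : ℂ) • v) := by
  set Wg : Fin n → Fin n → ℂ := fun a b => (Wz a b : ℂ) / 720 with hWg
  set M : Fin n → Fin n → Fin n → ℂ := fun d x y => (Mz d x y : ℂ) / 10 with hMdef
  have hG : ∀ p x, ∑ a, rr pm p a * rr pm x a = (gz p x : ℂ) := by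
    intro p x
    rw [← hgz, Fintype.sum_prod_type, Finset.sum_comm, Finset.card_filter]
    push_cast
    refine Finset.sum_congr rfl fun z _ => ?_
    simp only [rr, RR, ite_mul, one_mul, zero_mul, Finset.sum_ite_eq', Finset.mem_univ, if_true]
  have hM : ∀ d x y, ∑ p, Wg d p * (∑ a, rr pm p a * rr pm x a) * (∑ b, rr pm p b * rr pm y b)
      = M d x y := by
    intro d x y
    simp only [hG, hWg, hMdef]
    have := congrArg (fun q : ℤ => (q : ℂ) / 720) (hMz d x y)
    push_cast at this
    rw [Finset.sum_div] at this
    rw [show (Mz d x y : ℂ) / 10 = 72 * (Mz d x y : ℂ) / 720 by ring, ← this]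
    refine Finset.sum_congr rfl fun p _ => ?_
    ring
  have hMd' : ∀ d x, M d x x = if d = x then 1 else 0 := by
    intro d x
    simp only [hMdef, hMd]
    split_ifs <;> norm_num
  have hE := weingarten μ pm hSW Wg (by
    intro s s'
    rw [← hMd' s s', ← hM]
    refine Finset.sum_congr rfl fun p _ => ?_
    rw [mul_assoc]
    congr 1
    simp only [sum_pair', RR_pair, Fintype.sum_prod_type, rr]
    rw [sum_fact]
    refine Finset.sum_congr rfl fun _ _ => Finset.sum_congr rfl fun _ _ =>
      Finset.sum_congr rfl fun _ _ => Finset.sum_congr rfl fun _ _ => ?_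
    ring)
  have hb : ∀ (x : ℝ) (v : Idx t → ℂ),
      ((1 / 2 : ℂ) • (P12 t μ + P23 t μ)).mulVec v = (x : ℂ) • v ↔
      (1/2 : ℂ) • (PP (rr pm) Wg (toH v) + QQ (rr pm) Wg (toH v)) = (x : ℂ) • toH v := by
    intro x v
    rw [← bridge12 μ pm Wg hE, ← bridge23 μ pm Wg hE, Matrix.smul_mulVec, Matrix.add_mulVec]
    constructor
    · intro h
      have := congrArg toH h
      exact this
    · intro h
      apply toH_inj
      exact h
  constructor
  · rintro x ⟨v, hv, h⟩
    refine upper (rr pm) Wg M hM hMd' (ann (rr pm) Wg M hM Mz hsym (fun _ _ _ => rfl) hz) x (toH v)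
      ?_ ((hb x v).mp h)
    intro h0
    exact hv (toH_inj h0)
  · have h1' : ∀ d, M d e s = if d = e ∨ d = s then 2/5 else 0 := by
      intro d
      simp only [hMdef, h1]
      split_ifs <;> norm_num
    obtain ⟨u, hu, h⟩ := lower (rr pm) Wg M hM hMd' e s h1'
      (fun d => by rw [← h1' d, hMdef]; simp only [hsym d s e]) hes (y, y)
      (by simp [rr, RR, he]) (by simp [rr, RR, hs])
    refine ⟨ofH u, ?_, ?_⟩
    · intro h0
      apply hu
      rw [← toH_ofH u, h0]
      rfl
    · rw [hb, toH_ofH]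
      exact h

end Bridge

section Data

def par6 : Fin 6 → Bool := ![true, false, false, false, true, true]

def Mzf {n : ℕ} (par : Fin n → Bool) (d x y : Fin n) : ℤ :=
  if x = y then (if d = x then 10 else 0)
  else if par x = par y then
    (if d = x ∨ d = y then 1 else if par d = par x then -1 else 2)
  else (if d = x ∨ d = y then 4 else 0)

def memo6 (b : Fin 6 → Fin 6 → ℤ) : Fin 6 → Fin 6 → ℤ :=
  ![![b 0 0, b 0 1, b 0 2, b 0 3, b 0 4, b 0 5],
    ![b 1 0, b 1 1, b 1 2, b 1 3, b 1 4, b 1 5],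
    ![b 2 0, b 2 1, b 2 2, b 2 3, b 2 4, b 2 5],
    ![b 3 0, b 3 1, b 3 2, b 3 3, b 3 4, b 3 5],
    ![b 4 0, b 4 1, b 4 2, b 4 3, b 4 4, b 4 5],
    ![b 5 0, b 5 1, b 5 2, b 5 3, b 5 4, b 5 5]]

lemma memo6_eq (b : Fin 6 → Fin 6 → ℤ) : memo6 b = b := by
  funext d e
  fin_cases d <;> fin_cases e <;> rfl

def sum6 (f : Fin 6 → ℤ) : ℤ := f 0 + f 1 + f 2 + f 3 + f 4 + f 5

def Mt6 : Fin 6 → Fin 6 → Fin 6 → ℤ :=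
  ![memo6 (Mzf par6 0), memo6 (Mzf par6 1), memo6 (Mzf par6 2), memo6 (Mzf par6 3),
    memo6 (Mzf par6 4), memo6 (Mzf par6 5)]

lemma Mt6_eq : Mt6 = Mzf par6 := by
  funext d
  fin_cases d <;> exact memo6_eq _

def half6 (b : Fin 6 → Fin 6 → ℤ) : Fin 6 → Fin 6 → ℤ :=
  memo6 fun d y => sum6 fun x => Mt6 d x y * b x y

def step6 (lam : ℤ) (b h : Fin 6 → Fin 6 → ℤ) : Fin 6 → Fin 6 → ℤ :=
  memo6 fun d e => sum6 (fun y => Mt6 e d y * h d y) - lam * b d e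

lemma step6_eq (lam : ℤ) (b : Fin 6 → Fin 6 → ℤ) :
    step6 lam b (half6 b) = Tz (Mzf par6) lam b := by
  funext d e
  simp only [step6, half6, memo6_eq, Mt6_eq, Tz, sum6, Fin.sum_univ_six]

def full6 (lam : ℤ) (b : Fin 6 → Fin 6 → ℤ) : Fin 6 → Fin 6 → ℤ := step6 lam b (half6 b)

def chain6 (x y : Fin 6) : Fin 6 → Fin 6 → ℤ :=
  full6 0 (full6 100 (full6 16 (full6 4 (full6 1
      (memo6 (fun d e => if d = x ∧ e = y then 1 else 0))))))

lemma chain6_eq (x y : Fin 6) : chain6 x y = Tz (Mzf par6) 0 (Tz (Mzf par6) 100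
    (Tz (Mzf par6) 16 (Tz (Mzf par6) 4 (Tz (Mzf par6) 1
      (fun d e => if d = x ∧ e = y then 1 else 0))))) := by
  simp only [chain6, full6, step6_eq, memo6_eq]

lemma Tz_equivariant {n : ℕ} (Mz : Fin n → Fin n → Fin n → ℤ) (g : Equiv.Perm (Fin n))
    (hg : ∀ d x y, Mz (g d) (g x) (g y) = Mz d x y) (lam : ℤ) (b : Fin n → Fin n → ℤ) :
    (fun d e => Tz Mz lam b (g d) (g e)) = Tz Mz lam (fun d e => b (g d) (g e)) := by
  funext d e
  simp only [Tz]
  rw [← Equiv.sum_comp g]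
  congr 1
  refine Finset.sum_congr rfl fun y _ => ?_
  rw [← Equiv.sum_comp g]
  simp only [hg]

lemma chain6_move (g : Equiv.Perm (Fin 6))
    (hg : ∀ d x y, Mzf par6 (g d) (g x) (g y) = Mzf par6 d x y) (x y : Fin 6)
    (h : chain6 x y = fun _ _ => 0) : chain6 (g x) (g y) = fun _ _ => 0 := by
  have key : (fun d e => chain6 (g x) (g y) (g d) (g e)) = chain6 x y := by
    rw [chain6_eq, chain6_eq]
    simp only [Tz_equivariant _ g hg, EmbeddingLike.apply_eq_iff_eq]
  rw [h] at key
  funext d e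
  have := congrFun (congrFun key (g.symm d)) (g.symm e)
  simpa using this

/-- cyclic rotation of the odd permutations -/
def rho6 : Equiv.Perm (Fin 6) := Equiv.swap 1 2 * Equiv.swap 2 3
/-- exchange of the two 3-cycles -/
def sig6 : Equiv.Perm (Fin 6) := Equiv.swap 4 5
/-- a 6-cycle exchanging even and odd permutations -/
def tau6 : Equiv.Perm (Fin 6) := ⟨![1, 4, 5, 0, 2, 3], ![3, 0, 4, 5, 1, 2], by decide, by decide⟩

lemma rho6_inv : ∀ d x y, Mzf par6 (rho6 d) (rho6 x) (rho6 y) = Mzf par6 d x y := by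
  decide +kernel
lemma sig6_inv : ∀ d x y, Mzf par6 (sig6 d) (sig6 x) (sig6 y) = Mzf par6 d x y := by
  decide +kernel
lemma tau6_inv : ∀ d x y, Mzf par6 (tau6 d) (tau6 x) (tau6 y) = Mzf par6 d x y := by
  decide +kernel

lemma chain6_00 : ∀ d e, chain6 0 0 d e = 0 := by decide +kernel
lemma chain6_01 : ∀ d e, chain6 0 1 d e = 0 := by decide +kernel
lemma chain6_04 : ∀ d e, chain6 0 4 d e = 0 := by decide +kernel

lemma fin6_closure (P : Fin 6 → Fin 6 → Prop) (h00 : P 0 0) (h01 : P 0 1) (h04 : P 0 4)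
    (hr : ∀ x y, P x y → P (rho6 x) (rho6 y)) (hs : ∀ x y, P x y → P (sig6 x) (sig6 y))
    (ht : ∀ x y, P x y → P (tau6 x) (tau6 y)) : ∀ x y, P x y := by
  have h0 : ∀ y, P 0 y := by
    have h02 : P 0 2 := hr 0 1 h01
    have h03 : P 0 3 := hr 0 2 h02
    have h05 : P 0 5 := hs 0 4 h04
    intro y
    fin_cases y <;> assumption
  have hs : ∀ x, (∀ y, P x y) → ∀ y, P (tau6 x) y := by
    intro x hx y
    have := ht x (tau6.symm y) (hx _)
    rwa [Equiv.apply_symm_apply] at this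
  have h1 : ∀ y, P 1 y := hs 0 h0
  have h4 : ∀ y, P 4 y := hs 1 h1
  have h2 : ∀ y, P 2 y := hs 4 h4
  have h5 : ∀ y, P 5 y := hs 2 h2
  have h3 : ∀ y, P 3 y := hs 5 h5
  intro x
  fin_cases x <;> assumption

lemma chain6_zero (x y : Fin 6) : chain6 x y = fun _ _ => 0 :=
  fin6_closure (fun x y => chain6 x y = fun _ _ => 0)
    (by funext d e; exact chain6_00 d e) (by funext d e; exact chain6_01 d e)
    (by funext d e; exact chain6_04 d e)
    (fun x y h => chain6_move rho6 rho6_inv x y h) (fun x y h => chain6_move sig6 sig6_inv x y h)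
    (fun x y h => chain6_move tau6 tau6_inv x y h) x y

def pm3 : Fin 6 → Equiv.Perm (Fin 3) :=
  ![1, Equiv.swap 0 1, Equiv.swap 1 2, Equiv.swap 0 2, Equiv.swap 0 1 * Equiv.swap 1 2,
    Equiv.swap 1 2 * Equiv.swap 0 1]

def gz6 (s p : Fin 6) : ℕ := if s = p then 8 else if par6 s = par6 p then 2 else 4
def Wz6 (s p : Fin 6) : ℤ := if s = p then 14 else if par6 s = par6 p then 2 else -4

lemma gz6_eq : ∀ s p, (Finset.univ.filter fun y : Fin 3 → Fin 2 => y ∘ pm3 s = y ∘ pm3 p).card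
    = gz6 s p := by decide +kernel
lemma Mz6_eq : ∀ d x y, ∑ p, Wz6 d p * gz6 p x * gz6 p y = 72 * Mzf par6 d x y := by decide +kernel

def par2 : Fin 2 → Bool := ![true, false]
def pm2 : Fin 2 → Equiv.Perm (Fin 2) := ![1, Equiv.swap 0 1]
def gz2 (s p : Fin 2) : ℕ := if s = p then 4 else 2
def Wz2 (s p : Fin 2) : ℤ := if s = p then 48 else -12

lemma gz2_eq : ∀ s p, (Finset.univ.filter fun y : Fin 2 → Fin 2 => y ∘ pm2 s = y ∘ pm2 p).card
    = gz2 s p := by decide +kernel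
lemma Mz2_eq : ∀ d x y, ∑ p, Wz2 d p * gz2 p x * gz2 p y = 72 * Mzf par2 d x y := by decide +kernel

lemma chain2_zero : ∀ x y d e, Tz (Mzf par2) 0 (Tz (Mzf par2) 100
    (Tz (Mzf par2) 16 (Tz (Mzf par2) 4 (Tz (Mzf par2) 1
      (fun d e => if d = x ∧ e = y then 1 else 0))))) d e = 0 := by decide +kernel

lemma Mzf_diag {n : ℕ} (par : Fin n → Bool) (d x : Fin n) :
    Mzf par d x x = if d = x then 10 else 0 := by simp [Mzf]

lemma Mzf_symm {n : ℕ} (par : Fin n → Bool) (d x y : Fin n) :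
    Mzf par d x y = Mzf par d y x := by
  by_cases h : x = y
  · rw [h]
  · by_cases h2 : par x = par y
    · simp [Mzf, h, Ne.symm h, h2, or_comm]
    · simp [Mzf, h, Ne.symm h, h2, Ne.symm h2, or_comm]

end Data


section Final

/-- the first element of `D` outside a list -/
def fresh (a b c : D) : D :=
  if (0, 0) ≠ a ∧ (0, 0) ≠ b ∧ (0, 0) ≠ c then (0, 0)
  else if (0, 1) ≠ a ∧ (0, 1) ≠ b ∧ (0, 1) ≠ c then (0, 1)
  else if (1, 0) ≠ a ∧ (1, 0) ≠ b ∧ (1, 0) ≠ c then (1, 0)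
  else (1, 1)

def ind (x y : D) : ℤ := if x = y then 1 else 0

/-- a scaled orthogonal matrix separating `a, a, b` placed at the columns `p, q, r` -/
def rotV (a b p q r x z : D) : ℤ :=
  if z = p then 3 * ind x a + 4 * ind x (fresh a b b)
  else if z = q then -4 * ind x a + 3 * ind x (fresh a b b)
  else if z = r then 5 * ind x b
  else 5 * ind x (fresh a b (fresh a b b))

def VV (a b c x z : D) : ℤ :=
  if a = b then
    if b = c then (if x.1 * z.1 + x.2 * z.2 = 1 then -1 else 1)
    else rotV a c (0, 0) (0, 1) (1, 0) x z
  else if b = c then rotV b a (0, 1) (1, 0) (0, 0) x z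
  else if a = c then rotV a b (0, 0) (1, 0) (0, 1) x z
  else if z = (0, 0) then ind x a
  else if z = (0, 1) then ind x b
  else if z = (1, 0) then ind x c
  else ind x (fresh a b c)

def mV (a b c : D) : ℤ :=
  if a = b then (if b = c then 2 else 5) else if b = c then 5 else if a = c then 5 else 1

def J3 : Fin 3 → D := ![(0, 0), (0, 1), (1, 0)]
def J2 : Fin 2 → D := ![(0, 0), (0, 1)]

lemma mV_ne : ∀ a b c, mV a b c ≠ 0 := by decide +kernel

lemma VV_orth : ∀ a b c x y, ∑ z, VV a b c x z * VV a b c y z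
    = if x = y then mV a b c * mV a b c else 0 := by decide +kernel

lemma hB3 : ∀ i : Fin 3 → D, (∀ d, cnt i d = cnt J3 d) → ∃ s, i = J3 ∘ pm3 s := by
  unfold cnt
  decide +kernel

lemma hC3 : ∀ s s', J3 ∘ pm3 s = J3 ∘ pm3 s' → s = s' := by decide +kernel

lemma hB2 : ∀ i : Fin 2 → D, (∀ d, cnt i d = cnt J2 d) → ∃ s, i = J2 ∘ pm2 s := by
  unfold cnt
  decide +kernel

lemma hC2 : ∀ s s', J2 ∘ pm2 s = J2 ∘ pm2 s' → s = s' := by decide +kernel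

lemma hD3a : ∀ j : Fin 3 → D, (∏ a, VV (j 0) (j 1) (j 2) (j a) (J3 a)) ≠ 0 := by decide +kernel

lemma hD3b : ∀ j j' : Fin 3 → D, (∀ d, cnt j' d = cnt j d) → j' ≠ j →
    ∏ a, VV (j 0) (j 1) (j 2) (j' a) (J3 a) = 0 := by
  unfold cnt
  decide +kernel

/-- third entry used to extend a pair to a triple -/
def ext2 (a b : D) : D := if a = b then a else fresh a b b

lemma hD2a : ∀ j : Fin 2 → D,
    (∏ a, VV (j 0) (j 1) (ext2 (j 0) (j 1)) (j a) (J2 a)) ≠ 0 := by decide +kernel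

lemma hD2b : ∀ j j' : Fin 2 → D, (∀ d, cnt j' d = cnt j d) → j' ≠ j →
    ∏ a, VV (j 0) (j 1) (ext2 (j 0) (j 1)) (j' a) (J2 a) = 0 := by
  unfold cnt
  decide +kernel

theorem main2 (μ : Measure (Matrix.unitaryGroup (Fin 2 × Fin 2) ℂ))
    [μ.IsHaarMeasure] [IsProbabilityMeasure μ] :
    (∀ x : ℝ,
      (∃ v, v ≠ 0 ∧
          ((1 / 2 : ℂ) • (P12 2 μ + P23 2 μ)).mulVec v = (x : ℂ) • v) →
        x = 1 ∨ x ≤ 7 / 10) ∧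
    (∃ v, v ≠ 0 ∧
      ((1 / 2 : ℂ) • (P12 2 μ + P23 2 μ)).mulVec v = ((7 / 10 : ℝ) : ℂ) • v) := by
  have hSW := schurWeyl (t := 2) (by norm_num) pm2 J2 hB2 hC2
    (fun j => ⟨VV (j 0) (j 1) (ext2 (j 0) (j 1)), mV (j 0) (j 1) (ext2 (j 0) (j 1)),
      mV_ne _ _ _, VV_orth _ _ _, hD2a j, hD2b j⟩)
  refine assemble μ pm2 hSW gz2 gz2_eq Wz2 (Mzf par2) Mz2_eq (Mzf_diag _) (Mzf_symm _) ?_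
    0 1 (by decide) (by decide) ![0, 1] rfl (by decide)
  intro x y
  funext d e
  exact chain2_zero x y d e

theorem main3 (μ : Measure (Matrix.unitaryGroup (Fin 2 × Fin 2) ℂ))
    [μ.IsHaarMeasure] [IsProbabilityMeasure μ] :
    (∀ x : ℝ,
      (∃ v, v ≠ 0 ∧
          ((1 / 2 : ℂ) • (P12 3 μ + P23 3 μ)).mulVec v = (x : ℂ) • v) →
        x = 1 ∨ x ≤ 7 / 10) ∧
    (∃ v, v ≠ 0 ∧
      ((1 / 2 : ℂ) • (P12 3 μ + P23 3 μ)).mulVec v = ((7 / 10 : ℝ) : ℂ) • v) := by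
  have hSW := schurWeyl (t := 3) (by norm_num) pm3 J3 hB3 hC3
    (fun j => ⟨VV (j 0) (j 1) (j 2), mV (j 0) (j 1) (j 2),
      mV_ne _ _ _, VV_orth _ _ _, hD3a j, hD3b j⟩)
  refine assemble μ pm3 hSW gz6 gz6_eq Wz6 (Mzf par6) Mz6_eq (Mzf_diag _) (Mzf_symm _) ?_
    0 1 (by decide) (by decide) ![0, 1, 0] rfl (by decide)
  intro x y
  rw [← chain6_eq]
  exact chain6_zero x y

end Final

end TQM

/-- For `t ∈ {2,3}`, the second largest eigenvalue of the 3-qubit open-chain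
moment operator `K_t = (1/2)(P^{(12)} + P^{(23)})` equals `7/10`: every eigenvalue of `K_t`
is `1` or at most `7/10`, and `7/10` is an eigenvalue. -/
theorem three_qubit_moment_second_eigenvalue
    (t : ℕ) (ht : t = 2 ∨ t = 3)
    (μ : Measure (Matrix.unitaryGroup (Fin 2 × Fin 2) ℂ))
    [μ.IsHaarMeasure] [IsProbabilityMeasure μ] :
    (∀ x : ℝ,
      (∃ v, v ≠ 0 ∧
          ((1 / 2 : ℂ) • (P12 t μ + P23 t μ)).mulVec v = (x : ℂ) • v) →
        x = 1 ∨ x ≤ 7 / 10) ∧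
    (∃ v, v ≠ 0 ∧
      ((1 / 2 : ℂ) • (P12 t μ + P23 t μ)).mulVec v = ((7 / 10 : ℝ) : ℂ) • v) := by
  rcases ht with rfl | rfl
  · exact TQM.main2 μ
  · exact TQM.main3 μ
end
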